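/- Let Ω be as in the context (a bounded simply connected domain with C² smooth boundary), and let S be a Szegő kernel for Ω. Then S is rational if and only if there exists a rational biholomorphism f of Ω onto the open unit disc D = {w ∈ ℂ : |w| < 1} such that the derivative f′ is the square of a rational function on Ω. -/

import Mathlib

open MeasureTheory Complex Set Metric ComplexConjugate Filter

noncomputable section

/-- `S` is a Szegő kernel for `Ω`: holomorphic in its first variable, hermitian, and
reproducing holomorphic functions from boundary integrals against arc length measure
(one-dimensional Hausdorff measure restricted to the boundary). -/
structure IsSzegoKernel (Ω : Set ℂ) (S : ℂ → ℂ → ℂ) : Prop where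
  continuousOn : ∀ a ∈ Ω, ContinuousOn (fun z => S z a) (closure Ω)
  holo : ∀ a ∈ Ω, DifferentiableOn ℂ (fun z => S z a) Ω
  hermitian : ∀ z ∈ Ω, ∀ w ∈ Ω, S z w = conj (S w z)
  reproducing : ∀ h : ℂ → ℂ, ContinuousOn h (closure Ω) → DifferentiableOn ℂ h Ω →
    ∀ a ∈ Ω, h a = ∫ ζ in frontier Ω, h ζ * conj (S ζ a) ∂μH[1]

/-- `f` is a rational function on `Ω`. -/
def IsRationalOn (f : ℂ → ℂ) (Ω : Set ℂ) : Prop :=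
  ∃ p q : Polynomial ℂ, (∀ z ∈ Ω, q.eval z ≠ 0) ∧ ∀ z ∈ Ω, f z = p.eval z / q.eval z

/-- `f` is a rational biholomorphism of `Ω` onto the open unit disc: a rational holomorphic
injection on `Ω` whose image is the unit disc. -/
def IsRationalBiholoOntoDisc (Ω : Set ℂ) (f : ℂ → ℂ) : Prop :=
  IsRationalOn f Ω ∧ DifferentiableOn ℂ f Ω ∧ Set.InjOn f Ω ∧ f '' Ω = Metric.ball (0:ℂ) 1

/-- regular `C²` periodic simple curve -/
structure RegCurve (γ : ℝ → ℂ) : Prop where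
  smooth : ContDiff ℝ 2 γ
  per : Function.Periodic γ 1
  inj : ∀ x y, γ x = γ y → |x - y| < 1 → x = y
  der : ∀ t, deriv γ t ≠ 0

/-- normal coordinates -/
def nrm (γ : ℝ → ℂ) (t s : ℝ) : ℂ := γ t + (s : ℂ) * (I * deriv γ t)

lemma per_lower {g : ℝ → ℝ} (hg : Continuous g) (hp : Function.Periodic g 1)
    (h : ∀ t, 0 < g t) : ∃ c > 0, ∀ t, c ≤ g t := by
  obtain ⟨x, hx, hm⟩ := (isCompact_Icc (a := (0:ℝ)) (b := 1)).exists_isMinOn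
    (nonempty_Icc.2 zero_le_one) hg.continuousOn
  refine ⟨g x, h x, fun t => ?_⟩
  obtain ⟨y, hy, hty⟩ := hp.exists_mem_Ico₀ one_pos t
  rw [hty]
  exact hm (Ico_subset_Icc_self hy)

lemma per_upper {g : ℝ → ℝ} (hg : Continuous g) (hp : Function.Periodic g 1) :
    ∃ c > 0, ∀ t, g t ≤ c := by
  obtain ⟨x, hx, hm⟩ := (isCompact_Icc (a := (0:ℝ)) (b := 1)).exists_isMaxOn
    (nonempty_Icc.2 zero_le_one) hg.continuousOn
  refine ⟨max (g x) 1, lt_of_lt_of_le one_pos (le_max_right _ _), fun t => ?_⟩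
  obtain ⟨y, hy, hty⟩ := hp.exists_mem_Ico₀ one_pos t
  rw [hty]
  exact (hm (Ico_subset_Icc_self hy)).trans (le_max_left _ _)

lemma periodic_deriv {γ : ℝ → ℂ} (h : Function.Periodic γ 1) : Function.Periodic (deriv γ) 1 := by
  intro t
  have : (fun x => γ (x + 1)) = γ := funext h
  rw [← deriv_comp_add_const, this]

namespace RegCurve
variable {γ : ℝ → ℂ}

lemma cont (h : RegCurve γ) : Continuous γ := h.smooth.continuous
lemma diff (h : RegCurve γ) : Differentiable ℝ γ := h.smooth.differentiable (by norm_num)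
lemma hasDeriv (h : RegCurve γ) (t : ℝ) : HasDerivAt γ (deriv γ t) t := (h.diff t).hasDerivAt
lemma dC1 (h : RegCurve γ) : ContDiff ℝ 1 (deriv γ) := by
  have := h.smooth
  rw [show (2 : WithTop ℕ∞) = 1 + 1 by norm_num, contDiff_succ_iff_deriv] at this
  exact this.2.2
lemma dcont (h : RegCurve γ) : Continuous (deriv γ) := h.dC1.continuous
lemma ddiff (h : RegCurve γ) : Differentiable ℝ (deriv γ) := h.dC1.differentiable (by norm_num)
lemma dper (h : RegCurve γ) : Function.Periodic (deriv γ) 1 := periodic_deriv h.per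

lemma bounds (h : RegCurve γ) : ∃ m > 0, ∃ M > 0, ∃ C > 0, (∀ t, m ≤ ‖deriv γ t‖) ∧
    (∀ t, ‖deriv γ t‖ ≤ M) ∧ (∀ t, ‖deriv (deriv γ) t‖ ≤ C) ∧
    (∀ t τ, ‖γ (t + τ) - γ t - τ * deriv γ t‖ ≤ C * τ ^ 2) := by
  obtain ⟨m, hm, hm'⟩ := per_lower h.dcont.norm (fun t => by simp [h.dper t])
    (fun t => norm_pos_iff.2 (h.der t))
  obtain ⟨M, hM, hM'⟩ := per_upper h.dcont.norm (fun t => by simp [h.dper t])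
  have hcc : Continuous (deriv (deriv γ)) := h.dC1.continuous_deriv (by norm_num)
  obtain ⟨C, hC, hC'⟩ := per_upper hcc.norm (fun t => by
    simp [periodic_deriv h.dper t])
  refine ⟨m, hm, M, hM, C, hC, hm', hM', hC', fun t τ => ?_⟩
  have hlip : ∀ x y, ‖deriv γ x - deriv γ y‖ ≤ C * ‖x - y‖ := fun x y =>
    Convex.norm_image_sub_le_of_norm_deriv_le (s := univ) (fun z _ => h.ddiff z)
      (fun z _ => hC' z) convex_univ (mem_univ y) (mem_univ x)
  have hd : ∀ x, HasDerivAt (fun x : ℝ => γ x - (x : ℂ) * deriv γ t)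
      (deriv γ x - deriv γ t) x := by
    intro x
    have h2 : HasDerivAt (fun x : ℝ => (x : ℂ) * deriv γ t) (deriv γ t) x := by
      simpa using (Complex.ofRealCLM.hasDerivAt (x := x)).mul_const (deriv γ t)
    exact (h.hasDeriv x).sub h2
  have := Convex.norm_image_sub_le_of_norm_hasDerivWithin_le
    (f := fun x : ℝ => γ x - (x : ℂ) * deriv γ t) (f' := fun x => deriv γ x - deriv γ t)
    (C := C * |τ|) (s := uIcc t (t + τ))
    (fun x _ => (hd x).hasDerivWithinAt)
    (fun x hx => by
      refine (hlip x t).trans ?_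
      gcongr
      have := abs_sub_left_of_mem_uIcc hx
      simpa using this) (convex_uIcc _ _) left_mem_uIcc right_mem_uIcc
  have e : γ (t + τ) - ((t + τ : ℝ) : ℂ) * deriv γ t - (γ t - (t : ℂ) * deriv γ t)
      = γ (t + τ) - γ t - τ * deriv γ t := by push_cast; ring
  rw [e] at this
  refine this.trans (le_of_eq ?_)
  simp only [add_sub_cancel_left, Real.norm_eq_abs]
  rw [mul_assoc, abs_mul_abs_self, sq]

lemma chord (h : RegCurve γ) {η : ℝ} (hη : 0 < η) :
    ∃ c > 0, ∀ t τ, η ≤ |τ| → |τ| ≤ 1/2 → c ≤ ‖γ (t + τ) - γ t‖ := by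
  by_cases hη2 : η ≤ 1/2
  swap
  · exact ⟨1, one_pos, fun t τ h1 h2 => absurd (h1.trans h2) hη2⟩
  have hK : IsCompact (Icc (0:ℝ) 1 ×ˢ (Icc (-1/2 : ℝ) (1/2) ∩ {τ | η ≤ |τ|})) :=
    isCompact_Icc.prod (isCompact_Icc.inter_right (isClosed_le continuous_const continuous_abs))
  have hf : Continuous (fun p : ℝ × ℝ => ‖γ (p.1 + p.2) - γ p.1‖) := by
    have := h.cont
    fun_prop
  obtain ⟨x, hx, hm⟩ := hK.exists_isMinOn ⟨(0, 1/2), by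
    simp only [mem_prod, mem_Icc, mem_inter_iff, mem_ofPred_eq]
    refine ⟨by norm_num, by norm_num, ?_⟩
    rw [abs_of_pos (by norm_num)]; exact hη2⟩ hf.continuousOn
  refine ⟨‖γ (x.1 + x.2) - γ x.1‖, ?_, fun t τ h1 h2 => ?_⟩
  · rw [gt_iff_lt, norm_pos_iff, sub_ne_zero]
    intro he
    obtain ⟨-, ⟨h1, h2⟩, h3⟩ := hx
    have h3 : η ≤ |x.2| := h3
    have := h.inj _ _ he (by
      rw [add_sub_cancel_left, abs_lt]; constructor <;> linarith)
    have h0 : x.2 = 0 := by linarith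
    rw [h0, abs_zero] at h3
    linarith
  · have hp : Function.Periodic (fun t => ‖γ (t + τ) - γ t‖) 1 := fun t => by
      show ‖γ (t + 1 + τ) - γ (t + 1)‖ = _
      rw [h.per, show t + 1 + τ = t + τ + 1 by ring, h.per]
    obtain ⟨y, hy, hty⟩ := hp.exists_mem_Ico₀ one_pos t
    rw [show ‖γ (t + τ) - γ t‖ = _ from hty]
    refine hm (a := (y, τ)) ⟨Ico_subset_Icc_self hy, ?_, h1⟩
    have := abs_le.1 h2
    exact ⟨by linarith [this.1], this.2⟩

/-- main lower bound in normal coordinates -/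
lemma lb (h : RegCurve γ) : ∃ c > 0, ∃ s0 > 0, ∀ t s τ, |s| ≤ s0 → |τ| ≤ 1/2 →
    c * (|s| + |τ|) ≤ ‖nrm γ t s - γ (t + τ)‖ := by
  obtain ⟨m, hm, M, hM, C, hC, hmb, hMb, -, hT⟩ := h.bounds
  obtain ⟨c1, hc1, hch⟩ := h.chord (η := m / (4 * C)) (by positivity)
  refine ⟨min (m/4) (c1/2), by positivity, min (1/2) (c1/(2*M)), by positivity, ?_⟩
  intro t s τ hs hτ
  have e : nrm γ t s - γ (t + τ) = (s * I - τ) * deriv γ t - (γ (t + τ) - γ t - τ * deriv γ t) := by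
    unfold nrm; ring
  have hsM : ‖(s:ℂ) * (I * deriv γ t)‖ ≤ |s| * M := by
    simp only [norm_mul, norm_real, Real.norm_eq_abs, norm_I, one_mul]
    gcongr; exact hMb t
  rcases le_total (m / (4 * C)) |τ| with hτ' | hτ'
  · have h1 := hch t τ hτ' hτ
    have h2 : |s| * M ≤ c1 / 2 := by
      have : |s| ≤ c1/(2*M) := hs.trans (min_le_right _ _)
      calc |s| * M ≤ c1/(2*M) * M := by gcongr
        _ = c1/2 := by field_simp
    have h3 : ‖γ (t + τ) - γ t‖ ≤ ‖nrm γ t s - γ (t + τ)‖ + ‖(s:ℂ) * (I * deriv γ t)‖ := by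
      have : γ (t + τ) - γ t = -(nrm γ t s - γ (t + τ)) + (s:ℂ) * (I * deriv γ t) := by
        unfold nrm; ring
      rw [this]
      exact (norm_add_le _ _).trans (by rw [norm_neg])
    have h4 : |s| + |τ| ≤ 1 := by
      have := hs.trans (min_le_left _ _); linarith
    calc min (m/4) (c1/2) * (|s| + |τ|) ≤ (c1/2) * 1 := by
          gcongr; exact min_le_right _ _
      _ ≤ _ := by linarith
  · have h1 := hT t τ
    have h2 : (|s| + |τ|)/2 ≤ ‖(s * I - τ : ℂ)‖ := by
      have a1 : |s| ≤ ‖(s * I - τ : ℂ)‖ := by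
        have := abs_im_le_norm (s * I - τ : ℂ); simpa using this
      have a2 : |τ| ≤ ‖(s * I - τ : ℂ)‖ := by
        have := abs_re_le_norm (s * I - τ : ℂ); simpa using this
      linarith
    have h3 : (|s| + |τ|)/2 * m ≤ ‖(s * I - τ) * deriv γ t‖ := by
      rw [norm_mul]; gcongr; exact hmb t
    have h4 : ‖(s * I - τ) * deriv γ t‖ ≤ ‖nrm γ t s - γ (t + τ)‖ +
        ‖γ (t + τ) - γ t - τ * deriv γ t‖ := by
      rw [e]
      have := norm_sub_norm_le ((s * I - τ) * deriv γ t) (γ (t + τ) - γ t - τ * deriv γ t)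
      linarith
    have h5 : C * τ^2 ≤ m/4 * |τ| := by
      rw [← sq_abs, sq, ← mul_assoc]
      gcongr
      calc C * |τ| ≤ C * (m / (4 * C)) := by gcongr
        _ = m/4 := by field_simp
    calc min (m/4) (c1/2) * (|s| + |τ|) ≤ (m/4) * (|s| + |τ|) := by
          gcongr; exact min_le_left _ _
      _ ≤ _ := by nlinarith [abs_nonneg s, abs_nonneg τ]

lemma range_eq (h : RegCurve γ) : range γ = γ '' Icc 0 1 := by
  apply subset_antisymm
  · rintro _ ⟨t, rfl⟩
    obtain ⟨y, hy, hty⟩ := h.per.exists_mem_Ico₀ one_pos t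
    exact ⟨y, Ico_subset_Icc_self hy, hty.symm⟩
  · exact image_subset_range _ _

lemma compact (h : RegCurve γ) : IsCompact (range γ) := by
  rw [h.range_eq]; exact isCompact_Icc.image h.cont

lemma nearest (h : RegCurve γ) (z : ℂ) : ∃ t s, z = nrm γ t s ∧
    infDist z (range γ) = |s| * ‖deriv γ t‖ := by
  obtain ⟨_, ⟨t, rfl⟩, hd⟩ := h.compact.exists_infDist_eq_dist (range_nonempty γ) z
  have hmin : IsLocalMin (fun x => Complex.normSq (z - γ x)) t := by
    refine Filter.Eventually.of_forall fun x => ?_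
    have h1 : infDist z (range γ) ≤ dist z (γ x) := infDist_le_dist_of_mem (mem_range_self x)
    rw [hd, dist_eq_norm, dist_eq_norm] at h1
    simp only [Complex.normSq_eq_norm_sq]
    gcongr
  have hz : ∀ x, HasDerivAt (fun x => z - γ x) (-deriv γ x) x := fun x =>
    (h.hasDeriv x).const_sub z
  have hre : HasDerivAt (fun x => (z - γ x).re) (-deriv γ t).re t :=
    Complex.reCLM.hasFDerivAt.comp_hasDerivAt t (hz t)
  have him : HasDerivAt (fun x => (z - γ x).im) (-deriv γ t).im t :=
    Complex.imCLM.hasFDerivAt.comp_hasDerivAt t (hz t)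
  have hdd : HasDerivAt (fun x => Complex.normSq (z - γ x))
      ((-deriv γ t).re * (z - γ t).re + (z - γ t).re * (-deriv γ t).re +
       ((-deriv γ t).im * (z - γ t).im + (z - γ t).im * (-deriv γ t).im)) t := by
    simp only [Complex.normSq_apply]
    exact (hre.mul hre).add (him.mul him)
  have h0 := hmin.hasDerivAt_eq_zero hdd
  set w := (z - γ t) / deriv γ t with hw
  have hwz : z - γ t = w * deriv γ t := by rw [hw]; field_simp [h.der t]
  have hwre : w.re = 0 := by
    have hn : Complex.normSq (deriv γ t) ≠ 0 := by simpa using h.der t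
    rw [hwz] at h0
    simp at h0
    have : w.re * Complex.normSq (deriv γ t) = 0 := by
      rw [Complex.normSq_apply]; nlinarith
    rcases mul_eq_zero.1 this with h | h
    · exact h
    · exact absurd h hn
  have hwI : w = (w.im : ℂ) * I := by
    apply Complex.ext <;> simp [hwre]
  refine ⟨t, w.im, ?_, ?_⟩
  · unfold nrm
    rw [← mul_assoc, ← hwI, ← hwz]; ring
  · rw [hd, dist_eq_norm, hwz, norm_mul]
    congr 1
    rw [hwI]; simp

lemma nrm_cont (h : RegCurve γ) : Continuous (fun p : ℝ × ℝ => nrm γ p.1 p.2) := by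
  have := h.cont; have := h.dcont
  unfold nrm
  fun_prop

lemma nrm_add (h : RegCurve γ) (t s : ℝ) (n : ℤ) : nrm γ (t + n) s = nrm γ t s := by
  have h1 := h.per.int_mul n t
  have h2 := h.dper.int_mul n t
  simp only [mul_one] at h1 h2
  unfold nrm
  rw [h1, h2]

end RegCurve

/-- a bounded domain on the left of a regular curve -/
structure Dom (Ω : Set ℂ) (γ : ℝ → ℂ) : Prop where
  op : IsOpen Ω
  conn : IsConnected Ω
  bdd : Bornology.IsBounded Ω
  reg : RegCurve γ
  bdry : frontier Ω = range γ
  side : ∃ s0 > 0, ∀ t s, 0 < s → s ≤ s0 → nrm γ t s ∈ Ω ∧ nrm γ t (-s) ∉ closure Ω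

lemma shift_half (x t : ℝ) : ∃ (n : ℤ) (τ : ℝ), |τ| ≤ 1/2 ∧ x = t + τ + n := by
  refine ⟨round (x - t), x - t - round (x - t), abs_sub_round _, by ring⟩

lemma RegCurve.eval_add {γ : ℝ → ℂ} (h : RegCurve γ) (t : ℝ) (n : ℤ) : γ (t + n) = γ t := by
  have h1 := h.per.int_mul n t
  simpa using h1

lemma RegCurve.nrm_notMem {γ : ℝ → ℂ} (h : RegCurve γ) :
    ∃ s0 > 0, ∀ t s, s ≠ 0 → |s| ≤ s0 → nrm γ t s ∉ range γ := by
  obtain ⟨c, hc, s0, hs0, hlb⟩ := h.lb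
  refine ⟨s0, hs0, ?_⟩
  rintro t s hs hss ⟨x, hx⟩
  obtain ⟨n, τ, hτ, rfl⟩ := shift_half x t
  rw [h.eval_add] at hx
  have := hlb t s τ hss hτ
  rw [← hx, sub_self, norm_zero] at this
  have h1 : 0 < |s| := abs_pos.2 hs
  have h2 := abs_nonneg τ
  nlinarith [mul_pos hc h1, mul_nonneg hc.le h2]

lemma RegCurve.near {γ : ℝ → ℂ} (h : RegCurve γ) {s0 : ℝ} (hs0 : 0 < s0) :
    ∃ d0 > 0, ∀ z, infDist z (range γ) < d0 → ∃ t s, z = nrm γ t s ∧ |s| < s0 := by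
  obtain ⟨m, hm, M, hM, C, hC, hmb, hMb, -, hT⟩ := h.bounds
  refine ⟨m * s0, by positivity, fun z hz => ?_⟩
  obtain ⟨t, s, h1, h2⟩ := h.nearest z
  refine ⟨t, s, h1, ?_⟩
  rw [h2] at hz
  have : |s| * m ≤ |s| * ‖deriv γ t‖ := by gcongr; exact hmb t
  nlinarith

lemma conn_split {Ω A : Set ℂ} (hop : IsOpen Ω) (hA : IsPreconnected A)
    (hd : Disjoint A (frontier Ω)) : A ⊆ Ω ∨ A ⊆ (closure Ω)ᶜ := by
  refine hA.subset_or_subset hop isClosed_closure.isOpen_compl ?_ ?_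
  · exact disjoint_compl_right.mono_left subset_closure
  · intro z hz
    by_cases h : z ∈ closure Ω
    · left
      by_contra h'
      exact disjoint_left.1 hd hz ⟨h, by rwa [hop.interior_eq]⟩
    · right; exact h

lemma RegCurve.rev {γ : ℝ → ℂ} (h : RegCurve γ) : RegCurve (fun t => γ (-t)) where
  smooth := h.smooth.comp contDiff_neg
  per := fun t => by
    show γ (-(t+1)) = γ (-t)
    rw [← h.per]; congr 1; ring
  inj := fun x y hxy hd => by
    have := h.inj _ _ hxy (by rw [show -x - -y = -(x - y) by ring, abs_neg]; exact hd)
    linarith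
  der := fun t => by
    rw [deriv_comp_neg]
    exact neg_ne_zero.2 (h.der _)

lemma nrm_rev (γ : ℝ → ℂ) (t s : ℝ) : nrm (fun t => γ (-t)) t s = nrm γ (-t) (-s) := by
  unfold nrm
  rw [deriv_comp_neg]
  push_cast; ring

lemma range_rev (γ : ℝ → ℂ) : range (fun t => γ (-t)) = range γ := by
  ext z; constructor
  · rintro ⟨t, rfl⟩; exact ⟨-t, rfl⟩
  · rintro ⟨t, rfl⟩; exact ⟨-t, by simp⟩

lemma exists_dom {Ω : Set ℂ} (hop : IsOpen Ω) (hconn : IsConnected Ω)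
    (hbd : Bornology.IsBounded Ω) {γ : ℝ → ℂ} (h : RegCurve γ) (hb : frontier Ω = range γ) :
    ∃ γ', Dom Ω γ' := by
  obtain ⟨s0, hs0, hns⟩ := h.nrm_notMem
  obtain ⟨d0, hd0, hnear⟩ := h.near hs0
  have hA : IsPreconnected ((fun p : ℝ × ℝ => nrm γ p.1 p.2) '' (univ ×ˢ Ioc 0 s0)) :=
    (isPreconnected_univ.prod isPreconnected_Ioc).image _ h.nrm_cont.continuousOn
  have hB : IsPreconnected ((fun p : ℝ × ℝ => nrm γ p.1 (-p.2)) '' (univ ×ˢ Ioc 0 s0)) := by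
    refine (isPreconnected_univ.prod isPreconnected_Ioc).image _ ?_
    exact (h.nrm_cont.comp (f := fun p : ℝ × ℝ => (p.1, -p.2)) (by fun_prop)).continuousOn
  have hAd := conn_split hop hA (by
    rw [disjoint_left]
    rintro _ ⟨⟨t, s⟩, ⟨-, hs⟩, rfl⟩
    rw [hb]; exact hns t s hs.1.ne' (by rw [abs_of_pos hs.1]; exact hs.2))
  have hBd := conn_split hop hB (by
    rw [disjoint_left]
    rintro _ ⟨⟨t, s⟩, ⟨-, hs⟩, rfl⟩
    rw [hb]; exact hns t (-s) (neg_ne_zero.2 hs.1.ne')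
      (by rw [abs_neg, abs_of_pos hs.1]; exact hs.2))
  have hnb : ∀ b ∈ frontier Ω, ∀ᶠ z in nhds b, infDist z (range γ) < d0 := by
    intro b hbb
    have : Tendsto (fun z => infDist z (range γ)) (nhds b) (nhds (infDist b (range γ))) :=
      (continuous_infDist_pt _).continuousAt
    rw [infDist_zero_of_mem (by rwa [← hb])] at this
    exact this.eventually (gt_mem_nhds hd0)
  have hfr : ∀ t, γ t ∈ frontier Ω := fun t => by rw [hb]; exact mem_range_self t
  rcases hAd with hAd | hAd <;> rcases hBd with hBd | hBd
  · exfalso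
    have ho : IsOpen (closure Ω) := by
      rw [isOpen_iff_mem_nhds]
      intro z hz
      by_cases hzΩ : z ∈ Ω
      · exact mem_of_superset (hop.mem_nhds hzΩ) subset_closure
      · filter_upwards [hnb z ⟨hz, by rwa [hop.interior_eq]⟩] with w hw
        obtain ⟨t, s, rfl, hs⟩ := hnear w hw
        rcases lt_trichotomy s 0 with h0 | h0 | h0
        · refine subset_closure (hBd ⟨(t, -s), ⟨mem_univ _, ?_⟩, by simp⟩)
          rw [abs_of_neg h0] at hs
          constructor <;> simp <;> linarith
        · subst h0
          have : nrm γ t 0 = γ t := by simp [nrm]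
          rw [this]; exact frontier_subset_closure (hfr t)
        · refine subset_closure (hAd ⟨(t, s), ⟨mem_univ _, ?_⟩, rfl⟩)
          rw [abs_of_pos h0] at hs
          exact ⟨h0, hs.le⟩
    have huniv := IsClopen.eq_univ ⟨isClosed_closure, ho⟩ hconn.nonempty.closure
    have : IsCompact (closure Ω) := hbd.isCompact_closure
    rw [huniv] at this
    exact noncompact_univ ℂ this
  · refine ⟨γ, hop, hconn, hbd, h, hb, s0, hs0, fun t s h1 h2 => ⟨?_, ?_⟩⟩
    · exact hAd ⟨(t, s), ⟨mem_univ _, h1, h2⟩, rfl⟩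
    · exact hBd ⟨(t, s), ⟨mem_univ _, h1, h2⟩, rfl⟩
  · refine ⟨_, hop, hconn, hbd, h.rev, by rw [hb, range_rev], s0, hs0, fun t s h1 h2 => ⟨?_, ?_⟩⟩
    · rw [nrm_rev]
      exact hBd ⟨(-t, s), ⟨mem_univ _, h1, h2⟩, rfl⟩
    · rw [nrm_rev, neg_neg]
      exact hAd ⟨(-t, s), ⟨mem_univ _, h1, h2⟩, rfl⟩
  · exfalso
    have h0 := hfr 0
    have hcl := mem_closure_iff_frequently.1 (frontier_subset_closure h0)
    obtain ⟨z, hzΩ, hz⟩ := (hcl.and_eventually (hnb _ h0)).exists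
    obtain ⟨t, s, rfl, hs⟩ := hnear z hz
    rcases lt_trichotomy s 0 with h0 | h0 | h0
    · refine hBd ⟨(t, -s), ⟨mem_univ _, ?_⟩, rfl⟩ (by simpa using subset_closure hzΩ)
      rw [abs_of_neg h0] at hs
      constructor <;> simp <;> linarith
    · subst h0
      have : nrm γ t 0 = γ t := by simp [nrm]
      rw [this] at hzΩ
      exact (hfr t).2 (by rwa [hop.interior_eq])
    · refine hAd ⟨(t, s), ⟨mem_univ _, ?_⟩, rfl⟩ (subset_closure hzΩ)
      rw [abs_of_pos h0] at hs
      exact ⟨h0, hs.le⟩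

namespace Dom
variable {Ω : Set ℂ} {γ : ℝ → ℂ}

lemma mem_frontier (D : Dom Ω γ) (t : ℝ) : γ t ∈ frontier Ω := by
  rw [D.bdry]; exact mem_range_self t

lemma mem_closure (D : Dom Ω γ) (t : ℝ) : γ t ∈ closure Ω := frontier_subset_closure (D.mem_frontier t)

lemma notMem (D : Dom Ω γ) (t : ℝ) : γ t ∉ Ω := fun h => (D.mem_frontier t).2 (by rwa [D.op.interior_eq])

lemma ne_of_mem (D : Dom Ω γ) {z : ℂ} (hz : z ∈ Ω) (t : ℝ) : z ≠ γ t := fun h => D.notMem t (h ▸ hz)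

lemma cone (D : Dom Ω γ) (t : ℝ) (h : ℂ) (hh : 0 < (h / deriv γ t).im) :
    ∃ ε0 > 0, ∀ ε : ℝ, 0 < ε → ε < ε0 → γ t + ε * h ∈ Ω := by
  obtain ⟨s0, hs0, hside⟩ := D.side
  obtain ⟨c, hc, s1, hs1, hlb⟩ := D.reg.lb
  obtain ⟨m, hm, M, hM, C, hC, hmb, hMb, -, hT⟩ := D.reg.bounds
  set g := deriv γ t with hg
  have hg0 : g ≠ 0 := D.reg.der t
  set μ := min ((h / g).im) 1 with hμ
  have hμ0 : 0 < μ := by positivity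
  set B := max ‖h‖ ‖I * g‖ with hB
  have hB0 : 0 < B := lt_of_lt_of_le (by simp [hg0]) (le_max_right _ _)
  refine ⟨min s0 (min (c * (1/2) / B) (μ * c^2 * m / (C * B^2))), by positivity, ?_⟩
  intro ε hε hε2
  have e1 : ε ≤ s0 := hε2.le.trans (min_le_left _ _)
  have e3 : ε < μ * c^2 * m / (C * B^2) := hε2.trans_le ((min_le_right _ _).trans (min_le_right _ _))
  have hpre : IsPreconnected (segment ℝ (γ t + ε * h) (γ t + ε * (I * g))) :=
    (convex_segment _ _).isPreconnected
  have hdis : Disjoint (segment ℝ (γ t + ε * h) (γ t + ε * (I * g))) (frontier Ω) := by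
    rw [disjoint_left, D.bdry]
    rintro _ ⟨a, b, ha, hb, hab, rfl⟩ ⟨x, hx⟩
    obtain ⟨n, τ, hτ, rfl⟩ := shift_half x t
    rw [D.reg.eval_add] at hx
    set k : ℂ := a * h + b * (I * g) with hk
    have hx' : γ (t + τ) - γ t = ε * k := by
      rw [hx, hk]
      simp only [real_smul]
      have : (b : ℂ) = 1 - a := by rw [← ofReal_one, ← hab]; push_cast; ring
      rw [this]; ring
    have hkB : ‖k‖ ≤ B := by
      calc ‖k‖ ≤ a * ‖h‖ + b * ‖I * g‖ := by
            rw [hk]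
            refine (norm_add_le _ _).trans ?_
            simp [abs_of_nonneg ha, abs_of_nonneg hb]
        _ ≤ a * B + b * B := by
            gcongr
            · exact le_max_left _ _
            · exact le_max_right _ _
        _ = B := by rw [← add_mul, hab, one_mul]
    have hkμ : μ ≤ (k / g).im := by
      have : k / g = a * (h / g) + b * I := by rw [hk]; field_simp
      rw [this]
      simp only [add_im, mul_im, ofReal_re, ofReal_im, I_im, I_re]
      have h1 : μ ≤ (h/g).im := min_le_left _ _
      have h2 : μ ≤ 1 := min_le_right _ _
      nlinarith
    have hτb : c * |τ| ≤ ε * B := by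
      have := hlb t 0 τ (by simpa using hs1.le) hτ
      have e0 : nrm γ t 0 = γ t := by simp [nrm]
      rw [e0, norm_sub_rev, hx'] at this
      simp only [abs_zero, zero_add, norm_mul, norm_real, Real.norm_eq_abs, abs_of_pos hε] at this
      exact this.trans (by gcongr)
    have hIm : ε * μ ≤ C * τ^2 / m := by
      have h1 := hT t τ
      rw [hx', ← hg] at h1
      have h2 : (ε * k - τ * g) = (ε * (k/g) - τ) * g := by field_simp
      rw [h2, norm_mul] at h1
      have h3 : ε * μ ≤ ‖(ε * (k/g) - τ : ℂ)‖ := by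
        have := abs_im_le_norm (ε * (k/g) - τ : ℂ)
        have h4 : (ε * (k/g) - τ : ℂ).im = ε * (k/g).im := by simp
        rw [h4] at this
        refine le_trans ?_ ((le_abs_self _).trans this)
        gcongr
      rw [le_div_iff₀ hm]
      calc ε * μ * m ≤ ‖(ε * (k/g) - τ : ℂ)‖ * ‖g‖ := by gcongr; exact hmb t
        _ ≤ _ := h1
    have hτ2 : c^2 * τ^2 ≤ ε^2 * B^2 := by
      rw [← sq_abs τ, ← mul_pow, ← mul_pow]
      gcongr
    have e4 : ε * (C * B^2) < μ * c^2 * m := by rwa [lt_div_iff₀ (by positivity)] at e3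
    rw [le_div_iff₀ hm] at hIm
    have : ε * μ * m * c^2 ≤ C * (ε^2 * B^2) := by
      calc ε * μ * m * c^2 ≤ C * τ^2 * c^2 := by gcongr
        _ = C * (c^2 * τ^2) := by ring
        _ ≤ _ := by gcongr
    nlinarith
  rcases conn_split D.op hpre hdis with h1 | h1
  · exact h1 (left_mem_segment _ _ _)
  · exact absurd (subset_closure (hside t ε hε e1).1) (h1 (right_mem_segment _ _ _))

end Dom

lemma RegCurve.strict {γ : ℝ → ℂ} (h : RegCurve γ) (t : ℝ) {ε : ℝ} (hε : 0 < ε) :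
    ∃ δ > 0, ∀ x ∈ closedBall t δ, ∀ y ∈ closedBall t δ,
      ‖γ x - γ y - ((x - y : ℝ) : ℂ) * deriv γ t‖ ≤ ε * |x - y| := by
  have h1 : HasStrictDerivAt γ (deriv γ t) t :=
    h.smooth.contDiffAt.hasStrictDerivAt (by norm_num)
  have h2 := (hasStrictDerivAt_iff_hasStrictFDerivAt.1 h1).isLittleO.def hε
  rw [nhds_prod_eq] at h2
  obtain ⟨A, hA, hA2⟩ := Filter.mem_prod_same_iff.1 h2
  obtain ⟨δ, hδ, hb⟩ := nhds_basis_closedBall.mem_iff.1 hA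
  refine ⟨δ, hδ, fun x hx y hy => ?_⟩
  have := hA2 (show (x, y) ∈ A ×ˢ A from ⟨hb hx, hb hy⟩)
  simpa using this

lemma RegCurve.hausdorff_bounds {γ : ℝ → ℂ} (h : RegCurve γ) (t : ℝ) {ε : ℝ} (hε : 0 < ε)
    (hε2 : ε < ‖deriv γ t‖) :
    ∃ δ > 0, ∀ A ⊆ closedBall t δ, μH[1] (γ '' A) ≤ ENNReal.ofReal (‖deriv γ t‖ + ε) * volume A ∧
      ENNReal.ofReal (‖deriv γ t‖ - ε) * volume A ≤ μH[1] (γ '' A) := by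
  obtain ⟨δ, hδ, hs⟩ := h.strict t hε
  set g := ‖deriv γ t‖ with hg
  refine ⟨δ, hδ, fun A hA => ⟨?_, ?_⟩⟩
  · have hL : LipschitzOnWith (Real.toNNReal (g + ε)) γ A := by
      apply LipschitzOnWith.of_dist_le_mul
      intro x hx y hy
      have := hs x (hA hx) y (hA hy)
      rw [dist_eq_norm, Real.coe_toNNReal _ (by positivity), Real.dist_eq]
      have h2 : ‖γ x - γ y‖ ≤ ‖γ x - γ y - ((x - y : ℝ) : ℂ) * deriv γ t‖ +
        ‖((x - y : ℝ) : ℂ) * deriv γ t‖ := by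
        simpa using norm_add_le (γ x - γ y - ((x - y : ℝ) : ℂ) * deriv γ t) (((x - y : ℝ) : ℂ) * deriv γ t)
      rw [norm_mul, norm_real, Real.norm_eq_abs, ← hg] at h2
      linarith
    have := hL.hausdorffMeasure_image_le (d := 1) zero_le_one
    rw [hausdorffMeasure_real] at this
    simpa [ENNReal.ofReal] using this
  · have hlow : ∀ x ∈ A, ∀ y ∈ A, (g - ε) * |x - y| ≤ ‖γ x - γ y‖ := by
      intro x hx y hy
      have := hs x (hA hx) y (hA hy)
      have h2 := norm_sub_norm_le (((x - y : ℝ) : ℂ) * deriv γ t) (γ x - γ y)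
      rw [norm_mul, norm_real, Real.norm_eq_abs, ← hg, norm_sub_rev _ (γ x - γ y)] at h2
      linarith
    have hpos : 0 < g - ε := by linarith
    have hinj : InjOn γ A := by
      intro x hx y hy hxy
      have := hlow x hx y hy
      rw [hxy, sub_self, norm_zero] at this
      have h3 : |x - y| ≤ 0 := by
        by_contra hc
        push Not at hc
        nlinarith
      exact sub_eq_zero.1 (abs_nonpos_iff.1 h3)
    have hli := hinj.leftInvOn_invFunOn
    have hL : LipschitzOnWith (Real.toNNReal (g - ε)⁻¹) (Function.invFunOn γ A) (γ '' A) := by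
      apply LipschitzOnWith.of_dist_le_mul
      rintro _ ⟨x, hx, rfl⟩ _ ⟨y, hy, rfl⟩
      rw [hli hx, hli hy, Real.coe_toNNReal _ (by positivity), Real.dist_eq, dist_eq_norm,
        inv_mul_eq_div, le_div_iff₀ hpos, mul_comm]
      exact hlow x hx y hy
    have := hL.hausdorffMeasure_image_le (d := 1) zero_le_one
    rw [hausdorffMeasure_real, hli.image_image] at this
    have h2 : volume A ≤ (ENNReal.ofReal (g - ε))⁻¹ * μH[1] (γ '' A) := by
      rw [← ENNReal.ofReal_inv_of_pos hpos]
      simpa [ENNReal.ofReal] using this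
    calc _ ≤ ENNReal.ofReal (g - ε) * ((ENNReal.ofReal (g - ε))⁻¹ * μH[1] (γ '' A)) := by gcongr
      _ = _ := by
        rw [← mul_assoc, ENNReal.mul_inv_cancel (by simpa using hpos) ENNReal.ofReal_ne_top, one_mul]

theorem RegCurve.integral_eq {γ : ℝ → ℂ} (h : RegCurve γ) (g : ℂ → ℂ) :
    ∫ ζ in range γ, g ζ ∂μH[1] = ∫ t in (0:ℝ)..1, (‖deriv γ t‖ : ℂ) * g (γ t) := by
  obtain ⟨m, hm, M, hM, C, hC, hmb, hMb, -, hT⟩ := h.bounds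
  have hLip : LipschitzWith (Real.toNNReal M) γ := by
    apply LipschitzWith.of_dist_le_mul
    intro x y
    rw [dist_eq_norm, dist_eq_norm, Real.coe_toNNReal _ hM.le]
    exact Convex.norm_image_sub_le_of_norm_deriv_le (s := univ) (fun z _ => h.diff z)
      (fun z _ => hMb z) convex_univ (mem_univ y) (mem_univ x)
  set s : Set ℝ := Ico 0 1 with hs
  let e : s → ℂ := fun x => γ x
  have he : MeasurableEmbedding e := by
    have : StandardBorelSpace s := (measurableSet_Ico).standardBorel
    refine Measurable.measurableEmbedding (h.cont.comp continuous_subtype_val).measurable ?_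
    intro x y hxy
    have hx : 0 ≤ (x:ℝ) ∧ (x:ℝ) < 1 := x.2
    have hy : 0 ≤ (y:ℝ) ∧ (y:ℝ) < 1 := y.2
    exact Subtype.ext (h.inj _ _ hxy (by
      rw [abs_lt]; constructor <;> linarith [hx.1, hx.2, hy.1, hy.2]))
  have hre : range e = range γ := by
    apply subset_antisymm
    · rintro _ ⟨x, rfl⟩; exact ⟨x, rfl⟩
    · rintro _ ⟨t, rfl⟩
      obtain ⟨y, hy, hty⟩ := h.per.exists_mem_Ico₀ one_pos t
      exact ⟨⟨y, hy⟩, hty.symm⟩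
  have hv : MeasurableEmbedding (Subtype.val : s → ℝ) := MeasurableEmbedding.subtype_coe measurableSet_Ico
  set ν : Measure ℝ := ((μH[1] : Measure ℂ).comap e).map Subtype.val with hν
  have hνA : ∀ A, ν A = μH[1] (γ '' (A ∩ s)) := by
    intro A
    rw [hν, hv.map_apply, he.comap_apply]
    congr 1
    ext z; constructor
    · rintro ⟨x, hx, rfl⟩; exact ⟨x, ⟨hx, x.2⟩, rfl⟩
    · rintro ⟨x, ⟨hx, hxs⟩, rfl⟩; exact ⟨⟨x, hxs⟩, hx, rfl⟩
  have hνle : ∀ A, ν A ≤ ENNReal.ofReal M * volume (A ∩ s) := by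
    intro A
    rw [hνA]
    have := hLip.hausdorffMeasure_image_le (d := 1) zero_le_one (A ∩ s)
    rw [hausdorffMeasure_real] at this
    simpa [ENNReal.ofReal] using this
  have hνr : ν.restrict s = ν := by
    rw [Measure.restrict_eq_self_of_ae_mem]
    rw [ae_iff]
    refine le_antisymm ((hνle _).trans ?_) zero_le
    have : {a | a ∉ s} ∩ s = ∅ := by ext; simp
    rw [this]; simp
  have : IsFiniteMeasure ν := ⟨lt_of_le_of_lt (hνle _) (by
    rw [univ_inter, hs, Real.volume_Ico]
    exact ENNReal.mul_lt_top ENNReal.ofReal_lt_top ENNReal.ofReal_lt_top)⟩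
  have hac : ν ≪ volume := by
    refine Measure.AbsolutelyContinuous.mk fun A _ hA => ?_
    refine le_antisymm ((hνle _).trans ?_) zero_le
    rw [measure_mono_null inter_subset_left hA]; simp
  have hd : ∀ᵐ t ∂(volume : Measure ℝ), t ∈ Ioo (0:ℝ) 1 → ν.rnDeriv volume t = ENNReal.ofReal ‖deriv γ t‖ := by
    filter_upwards [Besicovitch.ae_tendsto_rnDeriv ν volume] with t ht hts
    have hgp : 0 < ‖deriv γ t‖ := norm_pos_iff.2 (h.der t)
    have key : ∀ ε, 0 < ε → ε < ‖deriv γ t‖ →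
        ν.rnDeriv volume t ≤ ENNReal.ofReal (‖deriv γ t‖ + ε) ∧
        ENNReal.ofReal (‖deriv γ t‖ - ε) ≤ ν.rnDeriv volume t := by
      intro ε hε hε2
      obtain ⟨δ, hδ, hb⟩ := h.hausdorff_bounds t hε hε2
      obtain ⟨δ', hδ', hb'⟩ := nhds_basis_closedBall.mem_iff.1 (Ioo_mem_nhds hts.1 hts.2)
      have hev : ∀ᶠ r in nhdsWithin (0:ℝ) (Ioi 0), r ∈ Ioo 0 (min δ δ') :=
        Ioo_mem_nhdsGT (by positivity)
      have hAA : ∀ r ∈ Ioo 0 (min δ δ'), closedBall t r ∩ s = closedBall t r ∧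
          closedBall t r ⊆ closedBall t δ := by
        intro r hr
        refine ⟨inter_eq_left.2 ?_, closedBall_subset_closedBall (hr.2.le.trans (min_le_left _ _))⟩
        exact ((closedBall_subset_closedBall (hr.2.le.trans (min_le_right _ _))).trans hb').trans
          Ioo_subset_Ico_self
      have hvpos : ∀ r ∈ Ioo 0 (min δ δ'), volume (closedBall t r) ≠ 0 := fun r hr =>
        (measure_closedBall_pos volume t hr.1).ne'
      constructor
      · refine le_of_tendsto ht ?_
        filter_upwards [hev] with r hr
        refine ENNReal.div_le_of_le_mul ?_
        rw [hνA, (hAA r hr).1]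
        exact (hb _ (hAA r hr).2).1
      · refine ge_of_tendsto ht ?_
        filter_upwards [hev] with r hr
        rw [ENNReal.le_div_iff_mul_le (Or.inl (hvpos r hr)) (Or.inl measure_closedBall_lt_top.ne)]
        rw [hνA, (hAA r hr).1]
        exact (hb _ (hAA r hr).2).2
    apply le_antisymm
    · have ht1 : Tendsto (fun ε : ℝ => ENNReal.ofReal (‖deriv γ t‖ + ε)) (nhdsWithin 0 (Ioi 0))
          (nhds (ENNReal.ofReal (‖deriv γ t‖ + 0))) := by
        refine ENNReal.tendsto_ofReal (Tendsto.mono_left ?_ nhdsWithin_le_nhds)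
        exact (continuous_const.add continuous_id).tendsto 0
      rw [add_zero] at ht1
      refine ge_of_tendsto ht1 ?_
      filter_upwards [Ioo_mem_nhdsGT hgp] with ε hε
      exact (key ε hε.1 hε.2).1
    · have ht1 : Tendsto (fun ε : ℝ => ENNReal.ofReal (‖deriv γ t‖ - ε)) (nhdsWithin 0 (Ioi 0))
          (nhds (ENNReal.ofReal (‖deriv γ t‖ - 0))) := by
        refine ENNReal.tendsto_ofReal (Tendsto.mono_left ?_ nhdsWithin_le_nhds)
        exact (continuous_const.sub continuous_id).tendsto 0
      rw [sub_zero] at ht1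
      refine le_of_tendsto ht1 ?_
      filter_upwards [Ioo_mem_nhdsGT hgp] with ε hε
      exact (key ε hε.1 hε.2).2
  calc ∫ ζ in range γ, g ζ ∂μH[1] = ∫ ζ, g ζ ∂(((μH[1] : Measure ℂ).comap e).map e) := by
        rw [he.map_comap, hre]
    _ = ∫ x, g (e x) ∂((μH[1] : Measure ℂ).comap e) := he.integral_map _
    _ = ∫ t, g (γ t) ∂ν := (hv.integral_map (fun t => g (γ t))).symm
    _ = ∫ t in s, g (γ t) ∂ν := by rw [hνr]
    _ = ∫ t in s, g (γ t) ∂(volume.withDensity (ν.rnDeriv volume)) := by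
        rw [Measure.withDensity_rnDeriv_eq _ _ hac]
    _ = ∫ t in s, (ν.rnDeriv volume t).toReal • g (γ t) := by
        rw [restrict_withDensity measurableSet_Ico]
        exact integral_withDensity_eq_integral_toReal_smul (Measure.measurable_rnDeriv _ _)
          (ae_restrict_of_ae (Measure.rnDeriv_lt_top _ _)) _
    _ = ∫ t in Ioo 0 1, (ν.rnDeriv volume t).toReal • g (γ t) := by
        rw [hs, setIntegral_congr_set Ioo_ae_eq_Ico]
    _ = ∫ t in Ioo 0 1, (‖deriv γ t‖ : ℂ) * g (γ t) := by
        refine setIntegral_congr_ae measurableSet_Ioo ?_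
        filter_upwards [hd] with t ht hts
        rw [ht hts, ENNReal.toReal_ofReal (norm_nonneg _), real_smul]
    _ = _ := by
        rw [intervalIntegral.integral_of_le zero_le_one, integral_Ioc_eq_integral_Ioo]

lemma cauchy_deriv {γ : ℝ → ℂ} (h : RegCurve γ) {c : ℝ → ℂ} (hc : Continuous c) {z : ℂ}
    (hz : z ∉ range γ) :
    HasDerivAt (fun z => ∫ x in (0:ℝ)..1, c x / (z - γ x)) (∫ x in (0:ℝ)..1, -c x / (z - γ x)^2) z := by
  have hd : 0 < infDist z (range γ) :=
    (h.compact.isClosed.notMem_iff_infDist_pos (range_nonempty γ)).1 hz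
  set d := infDist z (range γ) with hdd
  have hlow : ∀ w ∈ ball z (d/2), ∀ x, d/2 ≤ ‖w - γ x‖ := by
    intro w hw x
    have h1 : d ≤ dist z (γ x) := infDist_le_dist_of_mem (mem_range_self x)
    have h2 := dist_triangle z w (γ x)
    rw [mem_ball, dist_comm] at hw
    rw [← dist_eq_norm]; linarith
  have hne : ∀ w ∈ ball z (d/2), ∀ x, w - γ x ≠ 0 := fun w hw x h0 => by
    have := hlow w hw x
    rw [h0, norm_zero] at this; linarith
  have hcγ := h.cont
  have hz0 : z ∈ ball z (d/2) := mem_ball_self (by positivity)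
  have hcont : ∀ w ∈ ball z (d/2), Continuous (fun x => c x / (w - γ x)) := fun w hw =>
    hc.div (continuous_const.sub hcγ) (hne w hw)
  refine (intervalIntegral.hasDerivAt_integral_of_dominated_loc_of_deriv_le
    (F := fun z x => c x / (z - γ x)) (F' := fun z x => -c x / (z - γ x)^2)
    (bound := fun x => ‖c x‖ / (d/2)^2) (s := ball z (d/2)) (ball_mem_nhds z (by positivity)) ?_ ?_ ?_ ?_ ?_ ?_).2
  · filter_upwards [ball_mem_nhds z (show 0 < d/2 by positivity)] with w hw
    exact (hcont w hw).aestronglyMeasurable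
  · exact (hcont z hz0).intervalIntegrable _ _
  · exact (hc.neg.div ((continuous_const.sub hcγ).pow 2)
      (fun x => pow_ne_zero 2 (hne z hz0 x))).aestronglyMeasurable
  · refine Eventually.of_forall fun x _ w hw => ?_
    rw [norm_div, norm_neg, norm_pow]
    gcongr
    exact hlow w hw x
  · exact (hc.norm.div_const _).intervalIntegrable _ _
  · refine Eventually.of_forall fun x _ w hw => ?_
    have h1 := ((hasDerivAt_id w).sub_const (γ x)).inv (hne w hw x)
    have h2 := h1.const_mul (c x)
    refine (h2.congr_deriv ?_).congr_of_eventuallyEq (Eventually.of_forall fun y => ?_)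
    · simp; ring
    · simp [div_eq_mul_inv]

/-- data of a representing density -/
structure RepDensity (Ω : Set ℂ) (γ : ℝ → ℂ) (a : ℂ) (ρ : ℝ → ℝ) : Prop where
  mem : a ∈ Ω
  cont : Continuous ρ
  per : Function.Periodic ρ 1
  nonneg : ∀ t, 0 ≤ ρ t
  one : ∫ t in (0:ℝ)..1, ρ t = 1
  ext : ∀ z ∉ closure Ω, ∫ t in (0:ℝ)..1, (ρ t : ℂ) / (z - γ t) = 1 / (z - a)

def RR (ρ : ℝ → ℝ) (x : ℝ) : ℝ := ∫ t in (0:ℝ)..x, ρ t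

lemma RR_deriv {ρ : ℝ → ℝ} (hρ : Continuous ρ) (x : ℝ) : HasDerivAt (RR ρ) (ρ x) x :=
  intervalIntegral.integral_hasDerivAt_right (hρ.intervalIntegrable _ _)
    (hρ.stronglyMeasurableAtFilter _ _) hρ.continuousAt

lemma RR_cont {ρ : ℝ → ℝ} (hρ : Continuous ρ) : Continuous (RR ρ) :=
  continuous_iff_continuousAt.2 fun x => (RR_deriv hρ x).continuousAt

def NN (γ : ℝ → ℂ) (ρ : ℝ → ℝ) (z : ℂ) : ℂ := ∫ t in (0:ℝ)..1, (ρ t : ℂ) / (z - γ t)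

def WW (γ : ℝ → ℂ) (ρ : ℝ → ℝ) (z : ℂ) : ℂ :=
  ∫ x in (0:ℝ)..1, (-(deriv γ x * (1 - RR ρ x))) / (z - γ x)

def EE (γ : ℝ → ℂ) (ρ : ℝ → ℝ) (z : ℂ) : ℂ := (z - γ 0) * Complex.exp (WW γ ρ z)

section
variable {Ω : Set ℂ} {γ : ℝ → ℂ} {a : ℂ} {ρ : ℝ → ℝ}

lemma WW_deriv (h : RegCurve γ) (hρ : Continuous ρ) (h1 : ∫ t in (0:ℝ)..1, ρ t = 1) {z : ℂ}
    (hz : z ∉ range γ) : HasDerivAt (WW γ ρ) (NN γ ρ z - 1 / (z - γ 0)) z := by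
  have hRc := RR_cont hρ
  have hdc := h.dcont
  have hcγ := h.cont
  have hne : ∀ x, z - γ x ≠ 0 := fun x h0 => hz ⟨x, (sub_eq_zero.1 h0).symm⟩
  have hcc : Continuous (fun x => -(deriv γ x * (1 - (RR ρ x : ℂ)))) := by fun_prop
  refine (cauchy_deriv h hcc hz).congr_deriv ?_
  -- integrate by parts
  have hder : ∀ x ∈ uIcc (0:ℝ) 1, HasDerivAt (fun x => (1 - (RR ρ x : ℂ)) / (z - γ x))
      (- -(deriv γ x * (1 - (RR ρ x : ℂ))) / (z - γ x)^2 - (ρ x : ℂ) / (z - γ x)) x := by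
    intro x _
    have h2 : HasDerivAt (fun x => (1 - (RR ρ x : ℂ))) (-(ρ x : ℂ)) x :=
      (RR_deriv hρ x).ofReal_comp.const_sub 1
    have h3 : HasDerivAt (fun x => z - γ x) (-deriv γ x) x := (h.hasDeriv x).const_sub z
    refine (h2.div h3 (hne x)).congr_deriv ?_
    have := hne x
    field_simp
    ring
  have hc1 : Continuous (fun x => - -(deriv γ x * (1 - (RR ρ x : ℂ))) / (z - γ x)^2) :=
    hcc.neg.div (by fun_prop) (fun x => pow_ne_zero 2 (hne x))
  have hc2 : Continuous (fun x => (ρ x : ℂ) / (z - γ x)) :=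
    (continuous_ofReal.comp hρ).div (by fun_prop) hne
  have hftc := intervalIntegral.integral_eq_sub_of_hasDerivAt hder
    ((hc1.sub hc2).intervalIntegrable _ _)
  rw [intervalIntegral.integral_sub (hc1.intervalIntegrable _ _) (hc2.intervalIntegrable _ _)] at hftc
  have hR1 : RR ρ 1 = 1 := h1
  have hR0 : RR ρ 0 = 0 := by simp [RR]
  rw [hR1, hR0] at hftc
  simp only [ofReal_one, sub_self, zero_div, ofReal_zero, sub_zero, zero_sub] at hftc
  rw [sub_eq_iff_eq_add] at hftc
  rw [hftc]; unfold NN; ring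

lemma EE_ne (_h : RegCurve γ) {z : ℂ} (hz : z ∉ range γ) : EE γ ρ z ≠ 0 :=
  mul_ne_zero (fun h0 => hz ⟨0, (sub_eq_zero.1 h0).symm⟩) (Complex.exp_ne_zero _)

lemma EE_deriv (h : RegCurve γ) (hρ : Continuous ρ) (h1 : ∫ t in (0:ℝ)..1, ρ t = 1) {z : ℂ}
    (hz : z ∉ range γ) : HasDerivAt (EE γ ρ) (EE γ ρ z * NN γ ρ z) z := by
  have hne : z - γ 0 ≠ 0 := fun h0 => hz ⟨0, (sub_eq_zero.1 h0).symm⟩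
  have := ((hasDerivAt_id z).sub_const (γ 0)).mul (WW_deriv h hρ h1 hz).cexp
  refine this.congr_deriv ?_
  simp only [EE, id]
  field_simp
  ring

lemma log_norm_deriv (h : RegCurve γ) {z : ℂ} (hz : z ∉ range γ) (x : ℝ) :
    HasDerivAt (fun x => Real.log ‖z - γ x‖) ((-deriv γ x / (z - γ x)).re) x := by
  have hne : z - γ x ≠ 0 := fun h0 => hz ⟨x, (sub_eq_zero.1 h0).symm⟩
  have hzd : HasDerivAt (fun x => z - γ x) (-deriv γ x) x := (h.hasDeriv x).const_sub z
  have hre : HasDerivAt (fun x => (z - γ x).re) (-deriv γ x).re x :=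
    Complex.reCLM.hasFDerivAt.comp_hasDerivAt x hzd
  have him : HasDerivAt (fun x => (z - γ x).im) (-deriv γ x).im x :=
    Complex.imCLM.hasFDerivAt.comp_hasDerivAt x hzd
  have hn : HasDerivAt (fun x => Complex.normSq (z - γ x))
      ((-deriv γ x).re * (z - γ x).re + (z - γ x).re * (-deriv γ x).re +
       ((-deriv γ x).im * (z - γ x).im + (z - γ x).im * (-deriv γ x).im)) x := by
    simp only [Complex.normSq_apply]
    exact (hre.mul hre).add (him.mul him)
  have hns : Complex.normSq (z - γ x) ≠ 0 := by simpa using hne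
  have hl := (hn.log hns).const_mul (1/2)
  have e : (fun x => Real.log ‖z - γ x‖) = fun x => 1/2 * Real.log (Complex.normSq (z - γ x)) := by
    funext y
    rw [Complex.normSq_eq_norm_sq, Real.log_pow]; push_cast; ring
  rw [e]
  refine hl.congr_deriv ?_
  rw [Complex.div_re]
  ring

lemma EE_log (h : RegCurve γ) (hρ : Continuous ρ) (h1 : ∫ t in (0:ℝ)..1, ρ t = 1) {z : ℂ}
    (hz : z ∉ range γ) : Real.log ‖EE γ ρ z‖ = ∫ t in (0:ℝ)..1, ρ t * Real.log ‖z - γ t‖ := by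
  have hRc := RR_cont hρ
  have hdc := h.dcont
  have hcγ := h.cont
  have hne : ∀ x, z - γ x ≠ 0 := fun x h0 => hz ⟨x, (sub_eq_zero.1 h0).symm⟩
  have hWc : Continuous (fun x => -(deriv γ x * (1 - (RR ρ x : ℂ))) / (z - γ x)) :=
    Continuous.div (by fun_prop) (by fun_prop) hne
  have hlc : Continuous (fun x => ρ x * Real.log ‖z - γ x‖) :=
    hρ.mul (Continuous.log (by fun_prop) (fun x => norm_ne_zero_iff.2 (hne x)))
  have hder : ∀ x ∈ uIcc (0:ℝ) 1, HasDerivAt (fun x => (1 - RR ρ x) * Real.log ‖z - γ x‖)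
      ((-(deriv γ x * (1 - (RR ρ x : ℂ))) / (z - γ x)).re - ρ x * Real.log ‖z - γ x‖) x := by
    intro x _
    refine (((RR_deriv hρ x).const_sub 1).mul (log_norm_deriv h hz x)).congr_deriv ?_
    have : -(deriv γ x * (1 - (RR ρ x : ℂ))) / (z - γ x) =
      ((1 - RR ρ x : ℝ) : ℂ) * (-deriv γ x / (z - γ x)) := by push_cast; ring
    rw [this, re_ofReal_mul]; ring
  have hc1 : Continuous (fun x => (-(deriv γ x * (1 - (RR ρ x : ℂ))) / (z - γ x)).re) :=
    continuous_re.comp hWc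
  have hftc := intervalIntegral.integral_eq_sub_of_hasDerivAt hder
    ((hc1.sub hlc).intervalIntegrable _ _)
  rw [intervalIntegral.integral_sub (hc1.intervalIntegrable _ _) (hlc.intervalIntegrable _ _)] at hftc
  have hR1 : RR ρ 1 = 1 := h1
  have hR0 : RR ρ 0 = 0 := by simp [RR]
  rw [hR1, hR0] at hftc
  have hre : (WW γ ρ z).re = ∫ x in (0:ℝ)..1, (-(deriv γ x * (1 - (RR ρ x : ℂ))) / (z - γ x)).re := by
    have := Complex.reCLM.intervalIntegral_comp_comm (hWc.intervalIntegrable 0 1 (μ := volume))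
    exact this.symm
  unfold EE
  rw [norm_mul, Complex.norm_exp, Real.log_mul (norm_ne_zero_iff.2 (hne 0)) (Real.exp_ne_zero _),
    Real.log_exp, hre]
  linarith

end

def Phi (γ : ℝ → ℂ) (ρ : ℝ → ℝ) (a z : ℂ) : ℂ := (z - a) / EE γ ρ z

section
variable {Ω : Set ℂ} {γ : ℝ → ℂ} {a : ℂ} {ρ : ℝ → ℝ}

lemma int_shift {E : Type*} [NormedAddCommGroup E] [NormedSpace ℝ E] {f : ℝ → E}
    (hf : Function.Periodic f 1) (t : ℝ) :
    ∫ x in (0:ℝ)..1, f x = ∫ τ in (-(1/2):ℝ)..(1/2), f (t + τ) := by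
  rw [intervalIntegral.integral_comp_add_left]
  have := hf.intervalIntegral_add_eq 0 (t + -(1/2))
  rw [zero_add] at this
  rw [this]; congr 1; ring

lemma Phi_deriv (h : RegCurve γ) (hρ : Continuous ρ) (h1 : ∫ t in (0:ℝ)..1, ρ t = 1) {z : ℂ}
    (hz : z ∉ range γ) :
    HasDerivAt (Phi γ ρ a) ((1 - (z - a) * NN γ ρ z) / EE γ ρ z) z := by
  have hE : EE γ ρ z ≠ 0 := EE_ne h hz
  refine (((hasDerivAt_id z).sub_const a).div (EE_deriv h hρ h1 hz) hE).congr_deriv ?_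
  simp only [id]
  field_simp

lemma notMem_range_of_mem (D : Dom Ω γ) {z : ℂ} (hz : z ∈ Ω) : z ∉ range γ := by
  rintro ⟨t, rfl⟩; exact D.notMem t hz

lemma notMem_range_of_ext (D : Dom Ω γ) {z : ℂ} (hz : z ∉ closure Ω) : z ∉ range γ := by
  rintro ⟨t, rfl⟩; exact hz (D.mem_closure t)

lemma nrm_diff (γ : ℝ → ℂ) (t s : ℝ) : nrm γ t (-s) - nrm γ t s = -2 * s * (I * deriv γ t) := by
  unfold nrm; push_cast; ring

lemma NN_ext (R : RepDensity Ω γ a ρ) {z : ℂ} (hz : z ∉ closure Ω) : NN γ ρ z = 1 / (z - a) :=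
  R.ext z hz

lemma ext_ne (R : RepDensity Ω γ a ρ) {z : ℂ} (hz : z ∉ closure Ω) : z - a ≠ 0 := fun h =>
  hz (by rw [sub_eq_zero.1 h]; exact subset_closure R.mem)

lemma kappa (D : Dom Ω γ) (R : RepDensity Ω γ a ρ) {s0 : ℝ} (hs0 : 0 < s0)
    (hs : ∀ t s, 0 < s → s ≤ s0 → nrm γ t (-s) ∉ closure Ω) :
    ∃ κ : ℂ, κ ≠ 0 ∧ ∀ t s, 0 < s → s ≤ s0 → Phi γ ρ a (nrm γ t (-s)) = κ := by
  set A := (fun p : ℝ × ℝ => nrm γ p.1 (-p.2)) '' (univ ×ˢ Ioc 0 s0) with hA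
  have hAp : IsPreconnected A :=
    (isPreconnected_univ.prod isPreconnected_Ioc).image _
      (D.reg.nrm_cont.comp (continuous_fst.prodMk continuous_snd.neg)).continuousOn
  have hAs : A ⊆ (closure Ω)ᶜ := by
    rintro _ ⟨⟨t, s⟩, ⟨-, h1, h2⟩, rfl⟩
    exact hs t s h1 h2
  have hx0 : nrm γ 0 (-s0) ∈ A := ⟨(0, s0), ⟨trivial, hs0, le_rfl⟩, rfl⟩
  set U := connectedComponentIn (closure Ω)ᶜ (nrm γ 0 (-s0)) with hU
  have hUo : IsOpen U := isClosed_closure.isOpen_compl.connectedComponentIn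
  have hAU : A ⊆ U := hAp.subset_connectedComponentIn hx0 hAs
  have hUs : U ⊆ (closure Ω)ᶜ := connectedComponentIn_subset _ _
  have hder : ∀ z ∈ U, HasDerivAt (Phi γ ρ a) 0 z := by
    intro z hz
    refine (Phi_deriv D.reg R.cont R.one (notMem_range_of_ext D (hUs hz))).congr_deriv ?_
    rw [NN_ext R (hUs hz)]
    have := ext_ne R (hUs hz)
    field_simp; simp
  refine ⟨Phi γ ρ a (nrm γ 0 (-s0)), ?_, fun t s h1 h2 => ?_⟩
  · exact div_ne_zero (ext_ne R (hAs hx0)) (EE_ne D.reg (notMem_range_of_ext D (hAs hx0)))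
  · exact hUo.is_const_of_deriv_eq_zero isPreconnected_connectedComponentIn
      (fun z hz => (hder z hz).differentiableAt.differentiableWithinAt)
      (fun z hz => (hder z hz).deriv) (hAU ⟨(t, s), ⟨trivial, h1, h2⟩, rfl⟩) (hAU hx0)

lemma arctan_bound {s : ℝ} (hs : 0 < s) :
    ∫ τ in (-(1/2):ℝ)..(1/2), s / (s^2 + τ^2) ≤ Real.pi := by
  have hd : ∀ τ ∈ uIcc (-(1/2):ℝ) (1/2), HasDerivAt (fun τ => Real.arctan (τ / s)) (s / (s^2+τ^2)) τ := by
    intro τ _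
    refine (((hasDerivAt_id τ).div_const s).arctan).congr_deriv ?_
    simp only [id]
    field_simp
  have hc : Continuous (fun τ : ℝ => s / (s^2+τ^2)) :=
    continuous_const.div (by fun_prop) (fun τ => by positivity)
  rw [intervalIntegral.integral_eq_sub_of_hasDerivAt hd (hc.intervalIntegrable _ _)]
  have h1 := Real.arctan_lt_pi_div_two (1/2/s)
  have h2 := Real.neg_pi_div_two_lt_arctan (-(1/2)/s)
  linarith

/-- all constants for the strip -/
lemma strip_consts (D : Dom Ω γ) :
    ∃ s0 > 0, ∃ c > 0, ∃ M > 0, (∀ t, ‖deriv γ t‖ ≤ M) ∧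
      (∀ t s, 0 < s → s ≤ s0 → nrm γ t s ∈ Ω ∧ nrm γ t (-s) ∉ closure Ω) ∧
      (∀ t s τ, |s| ≤ s0 → |τ| ≤ 1/2 → c * (|s| + |τ|) ≤ ‖nrm γ t s - γ (t + τ)‖) ∧
      (∀ t s x, |s| ≤ s0 → c * |s| ≤ ‖nrm γ t s - γ x‖) := by
  obtain ⟨s0, hs0, hside⟩ := D.side
  obtain ⟨c, hc, s1, hs1, hlb⟩ := D.reg.lb
  obtain ⟨m, hm, M, hM, C, hC, hmb, hMb, -, hT⟩ := D.reg.bounds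
  refine ⟨min s0 s1, lt_min hs0 hs1, c, hc, M, hM, hMb,
    fun t s h1 h2 => hside t s h1 (h2.trans (min_le_left _ _)),
    fun t s τ h1 h2 => hlb t s τ (h1.trans (min_le_right _ _)) h2, fun t s x h1 => ?_⟩
  obtain ⟨n, τ, hτ, rfl⟩ := shift_half x t
  rw [D.reg.eval_add]
  refine le_trans ?_ (hlb t s τ (h1.trans (min_le_right _ _)) hτ)
  have := abs_nonneg τ
  nlinarith

lemma NN_jump_bound (D : Dom Ω γ) (hρ : Continuous ρ) (hp : Function.Periodic ρ 1) {s0 c M P : ℝ}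
    (hc : 0 < c) (hM : ∀ t, ‖deriv γ t‖ ≤ M) (hP : ∀ t, |ρ t| ≤ P)
    (hlb : ∀ t s τ, |s| ≤ s0 → |τ| ≤ 1/2 → c * (|s| + |τ|) ≤ ‖nrm γ t s - γ (t + τ)‖)
    {t s : ℝ} (hs : 0 < s) (hss : s ≤ s0) (hz : nrm γ t s ∉ range γ) (hz' : nrm γ t (-s) ∉ range γ) :
    ‖NN γ ρ (nrm γ t s) - NN γ ρ (nrm γ t (-s))‖ ≤ P * (2 * M) / c^2 * Real.pi := by
  have hM0 : 0 ≤ M := (norm_nonneg _).trans (hM 0)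
  have hP0 : 0 ≤ P := (abs_nonneg _).trans (hP 0)
  have hcγ := D.reg.cont
  set z := nrm γ t s
  set z' := nrm γ t (-s)
  have hne : ∀ x, z - γ x ≠ 0 := fun x h0 => hz ⟨x, (sub_eq_zero.1 h0).symm⟩
  have hne' : ∀ x, z' - γ x ≠ 0 := fun x h0 => hz' ⟨x, (sub_eq_zero.1 h0).symm⟩
  have hc1 : Continuous (fun x => (ρ x : ℂ) / (z - γ x)) :=
    (continuous_ofReal.comp hρ).div (by fun_prop) hne
  have hc2 : Continuous (fun x => (ρ x : ℂ) / (z' - γ x)) :=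
    (continuous_ofReal.comp hρ).div (by fun_prop) hne'
  unfold NN
  rw [← intervalIntegral.integral_sub (hc1.intervalIntegrable _ _) (hc2.intervalIntegrable _ _)]
  rw [int_shift (t := t) (fun x => by simp only [hp x, D.reg.per x])]
  have hcs : Continuous (fun τ : ℝ => P * (2 * M) / c^2 * (s / (s^2+τ^2))) :=
    continuous_const.mul (continuous_const.div (by fun_prop) (fun τ => by positivity))
  have hb : ∀ τ ∈ Ioc (-(1/2):ℝ) (1/2), ‖(ρ (t+τ) : ℂ) / (z - γ (t+τ)) - (ρ (t+τ) : ℂ) / (z' - γ (t+τ))‖ ≤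
      P * (2 * M) / c^2 * (s / (s^2+τ^2)) := by
    intro τ hτ
    have hτ' : |τ| ≤ 1/2 := abs_le.2 ⟨hτ.1.le, hτ.2⟩
    have e : (ρ (t+τ) : ℂ) / (z - γ (t+τ)) - (ρ (t+τ) : ℂ) / (z' - γ (t+τ)) =
      ρ (t+τ) * (z' - z) / ((z - γ (t+τ)) * (z' - γ (t+τ))) := by
      have := hne (t+τ); have := hne' (t+τ); field_simp; ring
    rw [e, nrm_diff, norm_div, norm_mul, norm_mul (z - γ (t+τ))]
    have l1 := hlb t s τ (by rw [abs_of_pos hs]; exact hss) hτ'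
    have l2 := hlb t (-s) τ (by rw [abs_neg, abs_of_pos hs]; exact hss) hτ'
    rw [abs_neg] at l2
    rw [abs_of_pos hs] at l1 l2
    have hpos : 0 < c * (s + |τ|) := by positivity
    have hnum : ‖(ρ (t+τ) : ℂ)‖ * ‖-2 * (s:ℂ) * (I * deriv γ t)‖ ≤ P * (2 * M) * s := by
      have e2 : ‖-2 * (s:ℂ) * (I * deriv γ t)‖ = 2 * s * ‖deriv γ t‖ := by
        simp [abs_of_pos hs]
      rw [e2, Complex.norm_real, Real.norm_eq_abs]
      calc |ρ (t+τ)| * (2 * s * ‖deriv γ t‖) ≤ P * (2 * s * M) := by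
            gcongr
            · exact hP _
            · exact hM _
        _ = _ := by ring
    have hden : c^2 * (s^2 + τ^2) ≤ ‖z - γ (t+τ)‖ * ‖z' - γ (t+τ)‖ := by
      calc c^2 * (s^2+τ^2) ≤ (c * (s+|τ|)) * (c * (s+|τ|)) := by
            have : s^2+τ^2 ≤ (s+|τ|)*(s+|τ|) := by
              rw [← sq_abs τ]; nlinarith [abs_nonneg τ]
            nlinarith [sq_nonneg c]
        _ ≤ _ := by gcongr
    calc _ ≤ P * (2 * M) * s / (c^2 * (s^2+τ^2)) :=
          div_le_div₀ (by positivity) hnum (by positivity) hden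
      _ = _ := by field_simp
  calc _ ≤ ∫ τ in (-(1/2):ℝ)..(1/2), P * (2 * M) / c^2 * (s / (s^2+τ^2)) :=
        intervalIntegral.norm_integral_le_of_norm_le (by norm_num)
          (Eventually.of_forall fun τ hτ => hb τ hτ) (hcs.intervalIntegrable _ _)
    _ = P * (2 * M) / c^2 * ∫ τ in (-(1/2):ℝ)..(1/2), (s / (s^2+τ^2)) := by
        rw [intervalIntegral.integral_const_mul]
    _ ≤ _ := by
        gcongr
        exact arctan_bound hs

lemma log_cmp {z z' g : ℂ} {k : ℝ} (hz : 0 < ‖z - g‖) (hz' : 0 < ‖z' - g‖)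
    (h1 : ‖z' - z‖ ≤ k * ‖z - g‖) (h2 : ‖z' - z‖ ≤ k * ‖z' - g‖) :
    |Real.log ‖z - g‖ - Real.log ‖z' - g‖| ≤ Real.log (1 + k) := by
  have hk : 0 ≤ k := by
    by_contra hk
    push Not at hk
    have := norm_nonneg (z' - z)
    nlinarith
  have a1 : ‖z - g‖ ≤ (1 + k) * ‖z' - g‖ := by
    have := norm_sub_le (z' - g) (z' - z)
    rw [show z' - g - (z' - z) = z - g by ring] at this
    linarith
  have a2 : ‖z' - g‖ ≤ (1 + k) * ‖z - g‖ := by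
    have := norm_add_le (z - g) (z' - z)
    rw [show z - g + (z' - z) = z' - g by ring] at this
    linarith
  have b1 := Real.log_le_log hz a1
  have b2 := Real.log_le_log hz' a2
  rw [Real.log_mul (by positivity) (by positivity)] at b1 b2
  rw [abs_le]; constructor <;> linarith

end

section
variable {Ω : Set ℂ} {γ : ℝ → ℂ} {a : ℂ} {ρ : ℝ → ℝ}

lemma EE_log_diff {s0 c M : ℝ}
    (hc : 0 < c) (hM : ∀ t, ‖deriv γ t‖ ≤ M)
    (hlb : ∀ t s x, |s| ≤ s0 → c * |s| ≤ ‖nrm γ t s - γ x‖)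
    {t s : ℝ} (hs : 0 < s) (hss : s ≤ s0) (x : ℝ) :
    |Real.log ‖nrm γ t s - γ x‖ - Real.log ‖nrm γ t (-s) - γ x‖| ≤ Real.log (1 + 2 * M / c) := by
  have l1 := hlb t s x (by rw [abs_of_pos hs]; exact hss)
  have l2 := hlb t (-s) x (by rw [abs_neg, abs_of_pos hs]; exact hss)
  rw [abs_neg] at l2
  rw [abs_of_pos hs] at l1 l2
  have hM0 : 0 ≤ M := (norm_nonneg _).trans (hM 0)
  have hd : ‖nrm γ t (-s) - nrm γ t s‖ ≤ 2 * M / c * (c * s) := by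
    rw [nrm_diff]
    have e2 : ‖-2 * (s:ℂ) * (I * deriv γ t)‖ = 2 * s * ‖deriv γ t‖ := by
      simp [abs_of_pos hs]
    rw [e2, show 2 * M / c * (c * s) = 2 * s * M by field_simp]
    gcongr
    exact hM t
  have hcs : 0 < c * s := by positivity
  refine log_cmp (hcs.trans_le l1) (hcs.trans_le l2) (hd.trans ?_) (hd.trans ?_) <;> gcongr

lemma EE_log_int (D : Dom Ω γ) (R : RepDensity Ω γ a ρ) {z z' : ℂ}
    (hz : z ∉ range γ) (hz' : z' ∉ range γ) :
    Real.log ‖EE γ ρ z‖ - Real.log ‖EE γ ρ z'‖ =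
      ∫ x in (0:ℝ)..1, ρ x * (Real.log ‖z - γ x‖ - Real.log ‖z' - γ x‖) := by
  have hlc : ∀ z ∉ range γ, Continuous (fun x => ρ x * Real.log ‖z - γ x‖) := by
    intro z hz
    have hne : ∀ x, z - γ x ≠ 0 := fun x h0 => hz ⟨x, (sub_eq_zero.1 h0).symm⟩
    exact R.cont.mul (Continuous.log (continuous_const.sub D.reg.cont).norm
      (fun x => norm_ne_zero_iff.2 (hne x)))
  rw [EE_log D.reg R.cont R.one hz, EE_log D.reg R.cont R.one hz',
    ← intervalIntegral.integral_sub ((hlc z hz).intervalIntegrable _ _)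
      ((hlc z' hz').intervalIntegrable _ _)]
  congr 1; ext x; ring

lemma nrm_tendsto (h : RegCurve γ) (t : ℝ) :
    Tendsto (fun s => nrm γ t s) (nhdsWithin 0 (Ioi 0)) (nhds (γ t)) := by
  have hc : Continuous (fun s => nrm γ t s) := h.nrm_cont.comp (continuous_const.prodMk continuous_id)
  have := (hc.tendsto 0).mono_left (nhdsWithin_le_nhds (s := Ioi 0))
  simpa [nrm] using this

lemma nrm_tendsto' (h : RegCurve γ) (t : ℝ) :
    Tendsto (fun s => nrm γ t (-s)) (nhdsWithin 0 (Ioi 0)) (nhds (γ t)) := by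
  have hc : Continuous (fun s => nrm γ t (-s)) := h.nrm_cont.comp (continuous_const.prodMk continuous_neg)
  have := (hc.tendsto 0).mono_left (nhdsWithin_le_nhds (s := Ioi 0))
  simpa [nrm] using this

/-- main strip facts -/
lemma strip_facts (D : Dom Ω γ) (R : RepDensity Ω γ a ρ) :
    ∃ s0 > 0, ∃ K > 0, ∃ κ : ℂ, κ ≠ 0 ∧
      (∀ t s, 0 < s → s ≤ s0 → nrm γ t s ∈ Ω ∧ nrm γ t (-s) ∉ closure Ω) ∧
      (∀ t s, 0 < s → s ≤ s0 → ‖deriv (Phi γ ρ a) (nrm γ t s)‖ ≤ K) ∧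
      (∀ t, Tendsto (fun s => ‖Phi γ ρ a (nrm γ t s)‖) (nhdsWithin 0 (Ioi 0)) (nhds ‖κ‖)) := by
  obtain ⟨s0, hs0, c, hc, M, hMp, hM, hside, hlb, hlb'⟩ := strip_consts D
  obtain ⟨κ, hκ, hκe⟩ := kappa D R hs0 (fun t s h1 h2 => (hside t s h1 h2).2)
  obtain ⟨P, hP0, hP⟩ := per_upper R.cont R.per
  obtain ⟨δ, hδ, hδΩ⟩ := Metric.isOpen_iff.1 D.op a R.mem
  obtain ⟨B, hB⟩ := D.bdd.subset_ball a
  have hdelta : ∀ z ∉ closure Ω, δ ≤ ‖z - a‖ := by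
    intro z hz
    by_contra hlt
    push Not at hlt
    exact hz (subset_closure (hδΩ (by rwa [mem_ball, dist_eq_norm])))
  have hPabs : ∀ t, |ρ t| ≤ P := fun t => by rw [abs_of_nonneg (R.nonneg t)]; exact hP t
  have hB0 : 0 < B := by
    have := hB R.mem
    rw [mem_ball, dist_self] at this; exact this
  have hBz : ∀ z ∈ Ω, ‖z - a‖ ≤ B := fun z hz => by
    have := hB hz
    rw [mem_ball, dist_eq_norm] at this; exact this.le
  set Lg := Real.log (1 + 2 * M / c) with hLg
  have hnr : ∀ t s, 0 < s → s ≤ s0 → nrm γ t s ∉ range γ := fun t s h1 h2 =>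
    notMem_range_of_mem D (hside t s h1 h2).1
  have hnr' : ∀ t s, 0 < s → s ≤ s0 → nrm γ t (-s) ∉ range γ := fun t s h1 h2 =>
    notMem_range_of_ext D (hside t s h1 h2).2
  -- formula for the norm of EE
  have hEform : ∀ t s, 0 < s → s ≤ s0 → ‖EE γ ρ (nrm γ t s)‖⁻¹ =
      ‖κ‖ / ‖nrm γ t (-s) - a‖ * Real.exp (-(Real.log ‖EE γ ρ (nrm γ t s)‖ - Real.log ‖EE γ ρ (nrm γ t (-s))‖)) := by
    intro t s h1 h2
    have e1 := EE_ne (ρ := ρ) D.reg (hnr t s h1 h2)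
    have e2 := EE_ne (ρ := ρ) D.reg (hnr' t s h1 h2)
    have e3 := ext_ne R (hside t s h1 h2).2
    rw [← hκe t s h1 h2]
    unfold Phi
    rw [neg_sub, Real.exp_sub, Real.exp_log (norm_pos_iff.2 e1), Real.exp_log (norm_pos_iff.2 e2), norm_div]
    have := norm_ne_zero_iff.2 e1
    have := norm_ne_zero_iff.2 e2
    have := norm_ne_zero_iff.2 e3
    field_simp
  have hdl : ∀ t s, 0 < s → s ≤ s0 → |Real.log ‖EE γ ρ (nrm γ t s)‖ - Real.log ‖EE γ ρ (nrm γ t (-s))‖| ≤ Lg := by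
    intro t s h1 h2
    rw [EE_log_int D R (hnr t s h1 h2) (hnr' t s h1 h2)]
    have := intervalIntegral.norm_integral_le_of_norm_le (a := 0) (b := 1) (μ := volume)
      (f := fun x => ρ x * (Real.log ‖nrm γ t s - γ x‖ - Real.log ‖nrm γ t (-s) - γ x‖))
      (g := fun x => ρ x * Lg) (by norm_num) (Eventually.of_forall fun x _ => by
        rw [norm_mul, Real.norm_eq_abs, abs_of_nonneg (R.nonneg x), Real.norm_eq_abs]
        exact mul_le_mul_of_nonneg_left (EE_log_diff hc hM hlb' h1 h2 x) (R.nonneg x))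
      ((R.cont.mul continuous_const).intervalIntegrable _ _)
    rw [intervalIntegral.integral_mul_const, R.one, one_mul] at this
    exact this
  set K := (1 + B * (P * (2 * M) / c^2 * Real.pi + 1 / δ)) * (‖κ‖ / δ * Real.exp Lg) with hK
  have hκp := norm_pos_iff.2 hκ
  have hKp : 0 < K := by have := Real.pi_pos; positivity
  refine ⟨s0, hs0, K, hKp, κ, hκ, hside, fun t s h1 h2 => ?_, fun t => ?_⟩
  · rw [(Phi_deriv D.reg R.cont R.one (hnr t s h1 h2)).deriv, div_eq_mul_inv, norm_mul, norm_inv, hK]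
    gcongr
    · have hj := NN_jump_bound D R.cont R.per hc hM hPabs hlb h1 h2 (hnr t s h1 h2) (hnr' t s h1 h2)
      rw [NN_ext R (hside t s h1 h2).2] at hj
      have h3 : ‖1 / (nrm γ t (-s) - a)‖ ≤ 1 / δ := by
        rw [norm_div, norm_one]
        have := hdelta _ (hside t s h1 h2).2
        gcongr
      have h4 : ‖NN γ ρ (nrm γ t s)‖ ≤ P * (2 * M) / c^2 * Real.pi + 1 / δ := by
        have := norm_sub_norm_le (NN γ ρ (nrm γ t s)) (1 / (nrm γ t (-s) - a))
        linarith
      calc _ ≤ ‖(1:ℂ)‖ + ‖(nrm γ t s - a) * NN γ ρ (nrm γ t s)‖ := norm_sub_le _ _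
        _ ≤ _ := by
          rw [norm_one, norm_mul]
          gcongr
          exact hBz _ (hside t s h1 h2).1
    · rw [hEform t s h1 h2]
      have := hdelta _ (hside t s h1 h2).2
      gcongr
      have := hdl t s h1 h2
      exact (neg_le_abs _).trans this
  · have hev : ∀ᶠ s in nhdsWithin (0:ℝ) (Ioi 0), 0 < s ∧ s ≤ s0 := by
      filter_upwards [Ioo_mem_nhdsGT hs0] with s hs
      exact ⟨hs.1, hs.2.le⟩
    have hlim : Tendsto (fun s => Real.log ‖EE γ ρ (nrm γ t s)‖ - Real.log ‖EE γ ρ (nrm γ t (-s))‖)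
        (nhdsWithin 0 (Ioi 0)) (nhds 0) := by
      have : Tendsto (fun s => ∫ x in (0:ℝ)..1, ρ x * (Real.log ‖nrm γ t s - γ x‖ - Real.log ‖nrm γ t (-s) - γ x‖))
        (nhdsWithin 0 (Ioi 0)) (nhds (∫ x in (0:ℝ)..1, (0:ℝ))) := by
        refine intervalIntegral.tendsto_integral_filter_of_dominated_convergence (fun x => ρ x * Lg) ?_ ?_ ?_ ?_
        · filter_upwards [hev] with s hs
          have hlc : ∀ z ∉ range γ, Continuous (fun x => Real.log ‖z - γ x‖) := by
            intro z hz
            have hne : ∀ x, z - γ x ≠ 0 := fun x h0 => hz ⟨x, (sub_eq_zero.1 h0).symm⟩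
            exact (Continuous.log (continuous_const.sub D.reg.cont).norm
              (fun x => norm_ne_zero_iff.2 (hne x)))
          exact (R.cont.mul ((hlc _ (hnr t s hs.1 hs.2)).sub (hlc _ (hnr' t s hs.1 hs.2)))).aestronglyMeasurable
        · filter_upwards [hev] with s hs
          refine Eventually.of_forall fun x _ => ?_
          rw [norm_mul, Real.norm_eq_abs, abs_of_nonneg (R.nonneg x), Real.norm_eq_abs]
          exact mul_le_mul_of_nonneg_left (EE_log_diff hc hM hlb' hs.1 hs.2 x) (R.nonneg x)
        · exact (R.cont.mul continuous_const).intervalIntegrable _ _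
        · refine Eventually.of_forall fun x _ => ?_
          by_cases hx : γ t - γ x = 0
          · have hx' : γ x = γ t := (sub_eq_zero.1 hx).symm
            refine tendsto_const_nhds.congr fun s => ?_
            simp [nrm, hx']
          · have h1 : Tendsto (fun s => Real.log ‖nrm γ t s - γ x‖) (nhdsWithin 0 (Ioi 0)) (nhds (Real.log ‖γ t - γ x‖)) :=
              (((nrm_tendsto D.reg t).sub_const (γ x)).norm).log (norm_ne_zero_iff.2 hx)
            have h2 : Tendsto (fun s => Real.log ‖nrm γ t (-s) - γ x‖) (nhdsWithin 0 (Ioi 0)) (nhds (Real.log ‖γ t - γ x‖)) :=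
              (((nrm_tendsto' D.reg t).sub_const (γ x)).norm).log (norm_ne_zero_iff.2 hx)
            simpa using (h1.sub h2).const_mul (ρ x)
      rw [intervalIntegral.integral_zero] at this
      refine this.congr' ?_
      filter_upwards [hev] with s hs
      exact (EE_log_int D R (hnr t s hs.1 hs.2) (hnr' t s hs.1 hs.2)).symm
    have hta : γ t - a ≠ 0 := fun h => D.notMem t (by rw [sub_eq_zero.1 h]; exact R.mem)
    have l1 : Tendsto (fun s => ‖nrm γ t s - a‖) (nhdsWithin 0 (Ioi 0)) (nhds ‖γ t - a‖) :=
      ((nrm_tendsto D.reg t).sub_const a).norm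
    have l2 : Tendsto (fun s => ‖nrm γ t (-s) - a‖) (nhdsWithin 0 (Ioi 0)) (nhds ‖γ t - a‖) :=
      ((nrm_tendsto' D.reg t).sub_const a).norm
    have l3 := hlim.neg.rexp
    have l4 := l1.mul (((tendsto_const_nhds (x := ‖κ‖)).div l2 (norm_ne_zero_iff.2 hta)).mul l3)
    have e : ‖γ t - a‖ * (‖κ‖ / ‖γ t - a‖ * Real.exp (-0)) = ‖κ‖ := by
      have := norm_ne_zero_iff.2 hta
      simp; field_simp
    rw [e] at l4
    refine l4.congr' ?_
    filter_upwards [hev] with s hs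
    unfold Phi
    rw [norm_div, div_eq_mul_inv ‖nrm γ t s - a‖, hEform t s hs.1 hs.2]
    rfl

end

section
variable {Ω : Set ℂ} {γ : ℝ → ℂ} {a : ℂ} {ρ : ℝ → ℝ}

lemma strip_lip (D : Dom Ω γ) {Φ : ℂ → ℂ} (hΦ : DifferentiableOn ℂ Φ Ω) {s0 K : ℝ} (hs0 : 0 < s0) (hK : 0 < K)
    (hside : ∀ t s, 0 < s → s ≤ s0 → nrm γ t s ∈ Ω)
    (hb : ∀ t s, 0 < s → s ≤ s0 → ‖deriv Φ (nrm γ t s)‖ ≤ K) :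
    ∃ K' > 0, ∀ t s t' s', 0 < s → s ≤ s0 → 0 < s' → s' ≤ s0 →
      ‖Φ (nrm γ t s) - Φ (nrm γ t' s')‖ ≤ K' * (|t - t'| + |s - s'|) := by
  obtain ⟨m, hm, M, hM, C, hC, hmb, hMb, hCb, hT⟩ := D.reg.bounds
  have hd : ∀ t s, 0 < s → s ≤ s0 → HasDerivAt Φ (deriv Φ (nrm γ t s)) (nrm γ t s) := fun t s h1 h2 =>
    ((hΦ _ (hside t s h1 h2)).differentiableAt (D.op.mem_nhds (hside t s h1 h2))).hasDerivAt
  have hnt : ∀ t s : ℝ, HasDerivAt (fun t => nrm γ t s) (deriv γ t + s * (I * deriv (deriv γ) t)) t := by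
    intro t s
    have h2 : HasDerivAt (deriv γ) (deriv (deriv γ) t) t := (D.reg.ddiff t).hasDerivAt
    exact (D.reg.hasDeriv t).add ((h2.const_mul I).const_mul (s:ℂ))
  have hns : ∀ t s : ℝ, HasDerivAt (fun s => nrm γ t s) (I * deriv γ t) s := by
    intro t s
    have h2 : HasDerivAt (fun s : ℝ => (s:ℂ)) 1 s := by simpa using (hasDerivAt_id s).ofReal_comp
    exact ((h2.mul_const (I * deriv γ t)).const_add (γ t)).congr_deriv (by simp)
  refine ⟨K * (M + s0 * C), by positivity, fun t s t' s' h1 h2 h3 h4 => ?_⟩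
  have A1 : ‖Φ (nrm γ t s) - Φ (nrm γ t' s)‖ ≤ K * (M + s0 * C) * ‖t - t'‖ := by
    refine convex_univ.norm_image_sub_le_of_norm_hasDerivWithin_le (𝕜 := ℝ)
      (f := fun t => Φ (nrm γ t s)) (f' := fun t => deriv Φ (nrm γ t s) * (deriv γ t + s * (I * deriv (deriv γ) t)))
      (fun x _ => ((hd x s h1 h2).comp x (hnt x s)).hasDerivWithinAt) (fun x _ => ?_)
      (mem_univ _) (mem_univ _)
    rw [norm_mul]
    have : ‖deriv γ x + s * (I * deriv (deriv γ) x)‖ ≤ M + s0 * C := by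
      refine (norm_add_le _ _).trans (add_le_add (hMb x) ?_)
      rw [norm_mul, norm_mul, Complex.norm_I, one_mul, Complex.norm_real, Real.norm_eq_abs, abs_of_pos h1]
      gcongr
      exact hCb x
    gcongr
    exact hb x s h1 h2
  have A2 : ‖Φ (nrm γ t' s) - Φ (nrm γ t' s')‖ ≤ K * (M + s0 * C) * ‖s - s'‖ := by
    refine (convex_Ioc 0 s0).norm_image_sub_le_of_norm_hasDerivWithin_le (𝕜 := ℝ)
      (f := fun s => Φ (nrm γ t' s)) (f' := fun s => deriv Φ (nrm γ t' s) * (I * deriv γ t'))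
      (fun x hx => ((hd t' x hx.1 hx.2).comp x (hns t' x)).hasDerivWithinAt) (fun x hx => ?_)
      ⟨h3, h4⟩ ⟨h1, h2⟩
    rw [norm_mul]
    have : ‖I * deriv γ t'‖ ≤ M + s0 * C := by
      rw [norm_mul, Complex.norm_I, one_mul]
      have := hMb t'
      have : 0 ≤ s0 * C := by positivity
      linarith
    gcongr
    exact hb t' x hx.1 hx.2
  calc _ ≤ ‖Φ (nrm γ t s) - Φ (nrm γ t' s)‖ + ‖Φ (nrm γ t' s) - Φ (nrm γ t' s')‖ := norm_sub_le_norm_sub_add_norm_sub _ _ _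
    _ ≤ _ := by rw [Real.norm_eq_abs] at A1 A2; linarith

lemma near_param (D : Dom Ω γ) {s0 : ℝ} (hs0 : 0 < s0)
    (hext : ∀ t s, 0 < s → s ≤ s0 → nrm γ t (-s) ∉ closure Ω) (t0 : ℝ) :
    ∃ d > 0, ∃ C > 0, ∀ z ∈ Ω, ‖z - γ t0‖ < d → ∃ t s, z = nrm γ t s ∧ 0 < s ∧ s ≤ s0 ∧
      |t - t0| + s ≤ C * ‖z - γ t0‖ := by
  obtain ⟨c, hc, s1, hs1, hlb⟩ := D.reg.lb
  obtain ⟨d, hd, hnear⟩ := D.reg.near (lt_min hs0 hs1)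
  refine ⟨d, hd, 1 / c, by positivity, fun z hz hzd => ?_⟩
  have h1 : infDist z (range γ) < d :=
    (infDist_le_dist_of_mem (mem_range_self t0)).trans_lt (by rwa [dist_eq_norm])
  obtain ⟨t, s, hzs, hsm⟩ := hnear z h1
  have hs0' := hsm.trans_le (min_le_left _ _)
  have hs1' := hsm.trans_le (min_le_right _ _)
  have hspos : 0 < s := by
    rcases lt_trichotomy s 0 with h | h | h
    · exfalso
      have := hext t (-s) (by linarith) (by rw [abs_of_neg h] at hs0'; exact hs0'.le)
      rw [neg_neg, ← hzs] at this
      exact this (subset_closure hz)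
    · exfalso
      rw [h] at hzs
      apply D.ne_of_mem hz t
      rw [hzs]; simp [nrm]
    · exact h
  rw [abs_of_pos hspos] at hs0'
  obtain ⟨n, τ, hτ, hteq⟩ := shift_half t0 t
  have hl := hlb t s τ hs1'.le hτ
  refine ⟨t + n, s, by rw [D.reg.nrm_add]; exact hzs, hspos, hs0'.le, ?_⟩
  rw [← D.reg.eval_add (t + τ) n, ← hteq, ← hzs, abs_of_pos hspos] at hl
  have : t + n - t0 = -τ := by rw [hteq]; ring
  rw [this, abs_neg, one_div, ← div_eq_inv_mul, le_div_iff₀ hc]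
  linarith

lemma strip_ext (D : Dom Ω γ) {Φ : ℂ → ℂ} (hΦ : DifferentiableOn ℂ Φ Ω) {s0 K : ℝ} (hs0 : 0 < s0) (hK : 0 < K)
    (hside : ∀ t s, 0 < s → s ≤ s0 → nrm γ t s ∈ Ω ∧ nrm γ t (-s) ∉ closure Ω)
    (hb : ∀ t s, 0 < s → s ≤ s0 → ‖deriv Φ (nrm γ t s)‖ ≤ K) :
    ContinuousOn (extendFrom Ω Φ) (closure Ω) := by
  obtain ⟨K', hK', hlip⟩ := strip_lip D hΦ hs0 hK (fun t s h1 h2 => (hside t s h1 h2).1) hb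
  refine continuousOn_extendFrom subset_rfl fun x hx => ?_
  by_cases hxΩ : x ∈ Ω
  · exact ⟨Φ x, (hΦ x hxΩ).continuousWithinAt⟩
  have hxf : x ∈ frontier Ω := ⟨hx, by rwa [D.op.interior_eq]⟩
  rw [D.bdry] at hxf
  obtain ⟨t0, rfl⟩ := hxf
  obtain ⟨d, hd, C, hC, hnp⟩ := near_param D hs0 (fun t s h1 h2 => (hside t s h1 h2).2) t0
  have : NeBot (nhdsWithin (γ t0) Ω) := mem_closure_iff_nhdsWithin_neBot.1 hx
  refine CompleteSpace.complete (Metric.cauchy_iff.2 ⟨inferInstance, fun ε hε => ?_⟩)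
  set η := min d (ε / (2 * K' * C)) with hη
  have hηp : 0 < η := lt_min hd (by positivity)
  refine ⟨Φ '' (Ω ∩ ball (γ t0) η), image_mem_map
    (inter_mem self_mem_nhdsWithin (mem_nhdsWithin_of_mem_nhds (ball_mem_nhds _ hηp))), ?_⟩
  rintro _ ⟨z, ⟨hz, hzb⟩, rfl⟩ _ ⟨w, ⟨hw, hwb⟩, rfl⟩
  rw [mem_ball, dist_eq_norm] at hzb hwb
  obtain ⟨t, s, e1, p1, p2, p3⟩ := hnp z hz (hzb.trans_le (min_le_left _ _))
  obtain ⟨t', s', e2, q1, q2, q3⟩ := hnp w hw (hwb.trans_le (min_le_left _ _))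
  rw [dist_eq_norm]
  have hL := hlip t s t' s' p1 p2 q1 q2
  rw [← e1, ← e2] at hL
  have hz2 := hzb.trans_le (min_le_right _ _)
  have hw2 := hwb.trans_le (min_le_right _ _)
  have a1 : |t - t'| ≤ |t - t0| + |t' - t0| := by
    rw [abs_sub_comm t' t0]; exact abs_sub_le _ _ _
  have a2 : |s - s'| ≤ s + s' := by rw [abs_le]; constructor <;> linarith
  have a3 : |t - t'| + |s - s'| ≤ C * ‖z - γ t0‖ + C * ‖w - γ t0‖ := by linarith
  calc _ ≤ K' * (|t - t'| + |s - s'|) := hL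
    _ ≤ K' * (C * ‖z - γ t0‖ + C * ‖w - γ t0‖) := by gcongr
    _ < K' * (C * (ε / (2 * K' * C)) + C * (ε / (2 * K' * C))) := by gcongr
    _ = ε := by field_simp; ring

lemma exists_F (D : Dom Ω γ) (R : RepDensity Ω γ a ρ) :
    ∃ F : ℂ → ℂ, ContinuousOn F (closure Ω) ∧ DifferentiableOn ℂ F Ω ∧ (∀ t, ‖F (γ t)‖ = 1) ∧
      ∃ κ : ℂ, κ ≠ 0 ∧ ∀ z ∈ Ω, F z = Phi γ ρ a z / κ := by
  obtain ⟨s0, hs0, K, hK, κ, hκ, hside, hb, hlim⟩ := strip_facts D R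
  have hΦ : DifferentiableOn ℂ (Phi γ ρ a) Ω := fun z hz =>
    (Phi_deriv D.reg R.cont R.one (notMem_range_of_mem D hz)).differentiableAt.differentiableWithinAt
  have hext := strip_ext D hΦ hs0 hK hside hb
  have heq : ∀ z ∈ Ω, extendFrom Ω (Phi γ ρ a) z = Phi γ ρ a z := fun z hz =>
    extendFrom_eq (subset_closure hz) (hΦ.continuousOn z hz)
  refine ⟨fun z => extendFrom Ω (Phi γ ρ a) z / κ, hext.div_const κ, ?_, fun t => ?_, κ, hκ, fun z hz => by
    simp only [heq z hz]⟩
  · exact (hΦ.div_const κ).congr fun z hz => by simp only [heq z hz]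
  · have h1 : Tendsto (fun s => ‖extendFrom Ω (Phi γ ρ a) (nrm γ t s)‖) (nhdsWithin 0 (Ioi 0))
        (nhds ‖extendFrom Ω (Phi γ ρ a) (γ t)‖) := by
      refine (Tendsto.comp (hext (γ t) (D.mem_closure t)) ?_).norm
      refine tendsto_nhdsWithin_of_tendsto_nhds_of_eventually_within _ (nrm_tendsto D.reg t) ?_
      filter_upwards [Ioo_mem_nhdsGT hs0] with s hs
      exact subset_closure (hside t s hs.1 hs.2.le).1
    have h2 : Tendsto (fun s => ‖extendFrom Ω (Phi γ ρ a) (nrm γ t s)‖) (nhdsWithin 0 (Ioi 0)) (nhds ‖κ‖) := by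
      refine (hlim t).congr' ?_
      filter_upwards [Ioo_mem_nhdsGT hs0] with s hs
      rw [heq _ (hside t s hs.1 hs.2.le).1]
    have h3 := tendsto_nhds_unique h1 h2
    show ‖extendFrom Ω (Phi γ ρ a) (γ t) / κ‖ = 1
    rw [norm_div, h3, div_self (norm_ne_zero_iff.2 hκ)]

end

section
variable {Ω : Set ℂ} {γ : ℝ → ℂ} {a : ℂ} {ρ : ℝ → ℝ}

lemma NN_diff_lim (D : Dom Ω γ) (R : RepDensity Ω γ a ρ) (t : ℝ) :
    Tendsto (fun s => NN γ ρ (nrm γ t s) - NN γ ρ (nrm γ t (-s))) (nhdsWithin 0 (Ioi 0))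
      (nhds (-2 * I * ρ t / deriv γ t * Real.pi)) := by
  obtain ⟨s0, hs0, c, hc, M, hMp, hM, hside, hlb, hlb'⟩ := strip_consts D
  obtain ⟨P, hP0, hP⟩ := per_upper R.cont R.per
  have hPabs : ∀ t, |ρ t| ≤ P := fun t => by rw [abs_of_nonneg (R.nonneg t)]; exact hP t
  have hcγ := D.reg.cont
  have hg0 := D.reg.der t
  have hnr : ∀ s, 0 < s → s ≤ s0 → ∀ x, nrm γ t s - γ x ≠ 0 := fun s h1 h2 x h0 =>
    D.ne_of_mem (hside t s h1 h2).1 x (sub_eq_zero.1 h0)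
  have hnr' : ∀ s, 0 < s → s ≤ s0 → ∀ x, nrm γ t (-s) - γ x ≠ 0 := fun s h1 h2 x h0 =>
    (hside t s h1 h2).2 (by rw [sub_eq_zero.1 h0]; exact D.mem_closure x)
  have hev : ∀ᶠ s in nhdsWithin (0:ℝ) (Ioi 0), 0 < s ∧ s ≤ s0 := by
    filter_upwards [Ioo_mem_nhdsGT hs0] with s hs
    exact ⟨hs.1, hs.2.le⟩
  set H : ℝ → ℝ → ℂ := fun s τ => ρ (t+τ) * (nrm γ t (-s) - nrm γ t s) /
    ((nrm γ t s - γ (t+τ)) * (nrm γ t (-s) - γ (t+τ))) with hH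
  have hHc : ∀ s, 0 < s → s ≤ s0 → Continuous (H s) := by
    intro s h1 h2
    have := R.cont
    refine Continuous.div (by fun_prop) (by fun_prop) (fun τ => mul_ne_zero (hnr s h1 h2 _) (hnr' s h1 h2 _))
  set G : ℝ → ℝ → ℂ := fun s u => (Ioc (-(1/(2*s))) (1/(2*s))).indicator (fun u => (s:ℂ) * H s (s*u)) u with hG
  have hrep : ∀ s, 0 < s → s ≤ s0 →
      NN γ ρ (nrm γ t s) - NN γ ρ (nrm γ t (-s)) = ∫ u, G s u := by
    intro s h1 h2
    have hc1 : Continuous (fun x => (ρ x : ℂ) / (nrm γ t s - γ x)) :=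
      (continuous_ofReal.comp R.cont).div (by fun_prop) (hnr s h1 h2)
    have hc2 : Continuous (fun x => (ρ x : ℂ) / (nrm γ t (-s) - γ x)) :=
      (continuous_ofReal.comp R.cont).div (by fun_prop) (hnr' s h1 h2)
    unfold NN
    rw [← intervalIntegral.integral_sub (hc1.intervalIntegrable _ _) (hc2.intervalIntegrable _ _)]
    rw [int_shift (t := t) (fun x => by simp only [R.per x, D.reg.per x])]
    have e : (fun τ => (ρ (t+τ) : ℂ) / (nrm γ t s - γ (t+τ)) - (ρ (t+τ) : ℂ) / (nrm γ t (-s) - γ (t+τ))) = H s := by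
      funext τ
      have := hnr s h1 h2 (t+τ); have := hnr' s h1 h2 (t+τ)
      simp only [hH]; field_simp; ring
    rw [e]
    have e2 := intervalIntegral.smul_integral_comp_mul_left (a := -(1/(2*s))) (b := 1/(2*s)) (H s) s
    rw [show s * -(1/(2*s)) = -(1/2) by field_simp, show s * (1/(2*s)) = 1/2 by field_simp] at e2
    rw [← e2, hG]
    simp only
    rw [integral_indicator measurableSet_Ioc, ← intervalIntegral.integral_of_le (by
      have : 0 < 1/(2*s) := by positivity
      linarith), intervalIntegral.integral_const_mul]
    exact Complex.real_smul
  have hlim : Tendsto (fun s => ∫ u, G s u) (nhdsWithin 0 (Ioi 0))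
      (nhds (∫ u : ℝ, (-2 * I * ρ t / deriv γ t) * ((1 + u^2)⁻¹ : ℝ))) := by
    refine tendsto_integral_filter_of_dominated_convergence (fun u => P * (2 * M) / c^2 * (1 + u^2)⁻¹) ?_ ?_ ?_ ?_
    · filter_upwards [hev] with s hs
      have : Continuous (fun u => (s:ℂ) * H s (s*u)) :=
        continuous_const.mul ((hHc s hs.1 hs.2).comp (continuous_const.mul continuous_id))
      exact this.aestronglyMeasurable.indicator measurableSet_Ioc
    · filter_upwards [hev] with s hs
      refine Eventually.of_forall fun u => ?_
      have hR : 0 ≤ P * (2 * M) / c^2 * (1 + u^2)⁻¹ := by positivity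
      simp only [hG]
      by_cases hu : u ∈ Ioc (-(1/(2*s))) (1/(2*s))
      swap
      · rw [indicator_of_notMem hu, norm_zero]; exact hR
      rw [indicator_of_mem hu]
      obtain ⟨h1, h2⟩ := hs
      have hsu : |s * u| = s * |u| := by rw [abs_mul, abs_of_pos h1]
      have hu' : |s * u| ≤ 1/2 := by
        have h3 : |u| ≤ 1/(2*s) := abs_le.2 ⟨hu.1.le, hu.2⟩
        rw [hsu]
        calc s * |u| ≤ s * (1/(2*s)) := by gcongr
          _ = 1/2 := by field_simp
      have l1 := hlb t s (s*u) (by rw [abs_of_pos h1]; exact h2) hu'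
      have l2 := hlb t (-s) (s*u) (by rw [abs_neg, abs_of_pos h1]; exact h2) hu'
      rw [abs_neg] at l2
      rw [abs_of_pos h1, hsu] at l1 l2
      simp only [hH]
      rw [nrm_diff, norm_mul, norm_div, norm_mul, norm_mul (nrm γ t s - γ (t + s * u))]
      have hnum : ‖(ρ (t+s*u) : ℂ)‖ * ‖-2 * (s:ℂ) * (I * deriv γ t)‖ ≤ P * (2 * M) * s := by
        have e2 : ‖-2 * (s:ℂ) * (I * deriv γ t)‖ = 2 * s * ‖deriv γ t‖ := by
          simp [abs_of_pos h1]
        rw [e2, Complex.norm_real, Real.norm_eq_abs]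
        calc |ρ (t+s*u)| * (2 * s * ‖deriv γ t‖) ≤ P * (2 * s * M) := by
              gcongr
              · exact hPabs _
              · exact hM _
          _ = _ := by ring
      have hden : c^2 * s^2 * (1 + u^2) ≤ ‖nrm γ t s - γ (t+s*u)‖ * ‖nrm γ t (-s) - γ (t+s*u)‖ := by
        calc c^2 * s^2 * (1 + u^2) ≤ (c * (s+s*|u|)) * (c * (s+s*|u|)) := by
              have : 1 + u^2 ≤ (1+|u|)*(1+|u|) := by
                rw [← sq_abs u]; nlinarith [abs_nonneg u]
              have h5 : 0 ≤ c^2 * s^2 := by positivity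
              nlinarith [mul_le_mul_of_nonneg_left this h5]
          _ ≤ _ := by gcongr
      rw [Complex.norm_real, Real.norm_eq_abs, abs_of_pos h1]
      calc _ ≤ s * (P * (2 * M) * s / (c^2 * s^2 * (1 + u^2))) :=
            mul_le_mul_of_nonneg_left (div_le_div₀ (by positivity) hnum (by positivity) hden) h1.le
        _ = _ := by field_simp
    · exact integrable_inv_one_add_sq.const_mul _
    · refine Eventually.of_forall fun u => ?_
      have hin : ∀ᶠ s in nhdsWithin (0:ℝ) (Ioi 0), u ∈ Ioc (-(1/(2*s))) (1/(2*s)) := by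
        have hp : 0 < 1 / (2 * (|u| + 1)) := by positivity
        filter_upwards [Ioo_mem_nhdsGT hp] with s hs
        have h3 : |u| + 1 < 1/(2*s) := by
          have h4 := hs.2
          have h5 := hs.1
          rw [lt_div_iff₀ (by positivity)] at h4 ⊢
          linarith
        have := abs_lt.1 (show |u| < 1/(2*s) by linarith)
        exact ⟨this.1, this.2.le⟩
      have hq : Tendsto (fun s : ℝ => (γ (t + s*u) - γ t) / s) (nhdsWithin 0 (Ioi 0)) (nhds (u * deriv γ t)) := by
        have h1 : HasDerivAt (fun s : ℝ => γ (t + s*u)) (u • deriv γ t) 0 := by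
          have h2 : HasDerivAt (fun s : ℝ => t + s * u) u 0 := by
            simpa using ((hasDerivAt_id (0:ℝ)).mul_const u).const_add t
          have h3 := D.reg.hasDeriv (t + 0 * u)
          have := h3.scomp (0:ℝ) h2
          rw [zero_mul, add_zero] at this
          exact this
        have h2 := (hasDerivAt_iff_tendsto_slope_zero.1 h1).mono_left
          (nhdsWithin_mono 0 (fun x (hx : 0 < x) => ne_of_gt hx))
        refine (h2.congr fun s => ?_).trans_eq ?_
        · simp [div_eq_inv_mul]
        · simp
      have hA : Tendsto (fun s : ℝ => (nrm γ t s - γ (t+s*u)) / s) (nhdsWithin 0 (Ioi 0))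
          (nhds (I * deriv γ t - u * deriv γ t)) := by
        refine ((tendsto_const_nhds (x := I * deriv γ t)).sub hq).congr' ?_
        filter_upwards [hev] with s hs
        have : (s:ℂ) ≠ 0 := by exact_mod_cast hs.1.ne'
        unfold nrm
        field_simp; ring
      have hB : Tendsto (fun s : ℝ => (nrm γ t (-s) - γ (t+s*u)) / s) (nhdsWithin 0 (Ioi 0))
          (nhds (-(I * deriv γ t) - u * deriv γ t)) := by
        refine ((tendsto_const_nhds (x := -(I * deriv γ t))).sub hq).congr' ?_
        filter_upwards [hev] with s hs
        have : (s:ℂ) ≠ 0 := by exact_mod_cast hs.1.ne'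
        unfold nrm
        push_cast
        field_simp; ring
      have hρl : Tendsto (fun s : ℝ => (ρ (t+s*u) : ℂ)) (nhdsWithin 0 (Ioi 0)) (nhds (ρ t)) := by
        have : Continuous (fun s : ℝ => (ρ (t+s*u) : ℂ)) := by have := R.cont; fun_prop
        have := (this.tendsto 0).mono_left (nhdsWithin_le_nhds (s := Ioi 0))
        simpa using this
      have hu1 : (1 + (u:ℂ)^2) ≠ 0 := by
        have : (1 + u^2 : ℝ) ≠ 0 := by positivity
        exact_mod_cast this
      have hprod : (I * deriv γ t - u * deriv γ t) * (-(I * deriv γ t) - u * deriv γ t) =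
          (deriv γ t)^2 * (1 + (u:ℂ)^2) := by
        ring_nf; rw [I_sq]; ring
      have hfin := (hρl.mul_const (-2 * (I * deriv γ t))).div (hA.mul hB) (by
        rw [hprod]; exact mul_ne_zero (pow_ne_zero 2 hg0) hu1)
      rw [hprod] at hfin
      have e3 : (ρ t : ℂ) * (-2 * (I * deriv γ t)) / ((deriv γ t)^2 * (1 + (u:ℂ)^2)) =
          (-2 * I * ρ t / deriv γ t) * ((1 + u^2)⁻¹ : ℝ) := by
        push_cast
        field_simp
      rw [e3] at hfin
      refine hfin.congr' ?_
      filter_upwards [hev, hin] with s hs hu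
      have : (s:ℂ) ≠ 0 := by exact_mod_cast hs.1.ne'
      have n1 := hnr s hs.1 hs.2 (t+s*u)
      have n2 := hnr' s hs.1 hs.2 (t+s*u)
      simp only [hG, indicator_of_mem hu, hH, nrm_diff, Pi.div_apply]
      field_simp
  have hval : (∫ u : ℝ, (-2 * I * ρ t / deriv γ t) * ((1 + u^2)⁻¹ : ℝ)) = -2 * I * ρ t / deriv γ t * Real.pi := by
    rw [integral_const_mul, integral_complex_ofReal, integral_univ_inv_one_add_sq]
  rw [hval] at hlim
  refine hlim.congr' ?_
  filter_upwards [hev] with s hs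
  exact (hrep s hs.1 hs.2).symm

lemma NN_lim (D : Dom Ω γ) (R : RepDensity Ω γ a ρ) (t : ℝ) :
    Tendsto (fun s => ‖1 / (nrm γ t s - a) - NN γ ρ (nrm γ t s)‖) (nhdsWithin 0 (Ioi 0))
      (nhds (2 * Real.pi * ρ t / ‖deriv γ t‖)) := by
  obtain ⟨s0, hs0, hside⟩ := D.side
  have hta : γ t - a ≠ 0 := fun h => D.notMem t (by rw [sub_eq_zero.1 h]; exact R.mem)
  have l1 : Tendsto (fun s => 1 / (nrm γ t s - a)) (nhdsWithin 0 (Ioi 0)) (nhds (1 / (γ t - a))) :=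
    tendsto_const_nhds.div ((nrm_tendsto D.reg t).sub_const a) hta
  have l2 : Tendsto (fun s => 1 / (nrm γ t (-s) - a)) (nhdsWithin 0 (Ioi 0)) (nhds (1 / (γ t - a))) :=
    tendsto_const_nhds.div ((nrm_tendsto' D.reg t).sub_const a) hta
  have l3 := ((l1.sub l2).sub (NN_diff_lim D R t)).norm
  have e : ‖1 / (γ t - a) - 1 / (γ t - a) - -2 * I * ρ t / deriv γ t * Real.pi‖ = 2 * Real.pi * ρ t / ‖deriv γ t‖ := by
    rw [sub_self, zero_sub, norm_neg]
    simp [abs_of_nonneg (R.nonneg t), abs_of_pos Real.pi_pos]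
    ring
  rw [e] at l3
  refine l3.congr' ?_
  filter_upwards [Ioo_mem_nhdsGT hs0] with s hs
  rw [NN_ext R (hside t s hs.1 hs.2.le).2]
  congr 1; ring

/-- The Riemann map attached to a representing density, with all needed facts. -/
structure RMap (Ω : Set ℂ) (γ : ℝ → ℂ) (a : ℂ) (ρ : ℝ → ℝ) (F : ℂ → ℂ) : Prop where
  cont : ContinuousOn F (closure Ω)
  diff : DifferentiableOn ℂ F Ω
  bd : ∀ t, ‖F (γ t)‖ = 1
  zero : F a = 0
  nz : ∀ z ∈ Ω, z ≠ a → F z ≠ 0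
  dz : deriv F a ≠ 0
  lim : ∀ t, Tendsto (fun s => ‖deriv F (nrm γ t s)‖) (nhdsWithin 0 (Ioi 0))
      (nhds (2 * Real.pi * ρ t / ‖deriv γ t‖))

lemma exists_RMap (D : Dom Ω γ) (R : RepDensity Ω γ a ρ) : ∃ F, RMap Ω γ a ρ F := by
  obtain ⟨F, hc, hd, hb, κ, hκ, hF⟩ := exists_F D R
  have hder : ∀ z ∈ Ω, HasDerivAt F ((1 - (z - a) * NN γ ρ z) / EE γ ρ z / κ) z := by
    intro z hz
    refine ((Phi_deriv D.reg R.cont R.one (notMem_range_of_mem D hz)).div_const κ).congr_of_eventuallyEq ?_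
    filter_upwards [D.op.mem_nhds hz] with w hw
    exact hF w hw
  refine ⟨F, hc, hd, hb, ?_, fun z hz hza => ?_, ?_, fun t => ?_⟩
  · rw [hF a R.mem]; simp [Phi]
  · rw [hF z hz]
    exact div_ne_zero (div_ne_zero (sub_ne_zero.2 hza) (EE_ne D.reg (notMem_range_of_mem D hz))) hκ
  · rw [(hder a R.mem).deriv]
    simp [hκ, EE_ne D.reg (notMem_range_of_mem D R.mem)]
  · obtain ⟨s0, hs0, hside⟩ := D.side
    have l1 : Tendsto (fun s => ‖F (nrm γ t s)‖) (nhdsWithin 0 (Ioi 0)) (nhds 1) := by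
      rw [← hb t]
      refine (Tendsto.comp (hc (γ t) (D.mem_closure t)) ?_).norm
      refine tendsto_nhdsWithin_of_tendsto_nhds_of_eventually_within _ (nrm_tendsto D.reg t) ?_
      filter_upwards [Ioo_mem_nhdsGT hs0] with s hs
      exact subset_closure (hside t s hs.1 hs.2.le).1
    have l2 := l1.mul (NN_lim D R t)
    rw [one_mul] at l2
    refine l2.congr' ?_
    have hta : γ t ≠ a := fun h => D.notMem t (by rw [h]; exact R.mem)
    have hne := (nrm_tendsto D.reg t).eventually_ne hta
    filter_upwards [Ioo_mem_nhdsGT hs0, hne] with s hs hsa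
    have hz := (hside t s hs.1 hs.2.le).1
    rw [(hder _ hz).deriv, hF _ hz, ← norm_mul]
    congr 1
    have := EE_ne (ρ := ρ) D.reg (notMem_range_of_mem D hz)
    have := sub_ne_zero.2 hsa
    unfold Phi
    field_simp

end

section
variable {Ω : Set ℂ} {γ : ℝ → ℂ} {a : ℂ} {ρ : ℝ → ℝ} {S : ℂ → ℂ → ℂ}

lemma Dom.bd_cont (D : Dom Ω γ) {h : ℂ → ℂ} (hh : ContinuousOn h (closure Ω)) :
    Continuous (fun t => h (γ t)) :=
  hh.comp_continuous D.reg.cont D.mem_closure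

lemma szego_diffCont (hS : IsSzegoKernel Ω S) (ha : a ∈ Ω) : DiffContOnCl ℂ (fun z => S z a) Ω :=
  ⟨hS.holo a ha, hS.continuousOn a ha⟩

lemma szego_repr (D : Dom Ω γ) (hS : IsSzegoKernel Ω S) (ha : a ∈ Ω) {h : ℂ → ℂ}
    (hh : DiffContOnCl ℂ h Ω) :
    ∫ t in (0:ℝ)..1, (‖deriv γ t‖ : ℂ) * (h (γ t) * conj (S (γ t) a)) = h a := by
  rw [hS.reproducing h hh.continuousOn hh.differentiableOn a ha, D.bdry, D.reg.integral_eq]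

lemma szego_unique (D : Dom Ω γ) {d : ℂ → ℂ} (hd : DiffContOnCl ℂ d Ω)
    (h0 : ∫ t in (0:ℝ)..1, (‖deriv γ t‖ : ℂ) * (d (γ t) * conj (d (γ t))) = 0) :
    ∀ z ∈ closure Ω, d z = 0 := by
  have hc := D.bd_cont hd.continuousOn
  have hdc := D.reg.dcont
  have h1 : ∀ t, d (γ t) = 0 := by
    have e : (fun t => (‖deriv γ t‖ : ℂ) * (d (γ t) * conj (d (γ t)))) =
        fun t => ((‖deriv γ t‖ * ‖d (γ t)‖^2 : ℝ) : ℂ) := by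
      funext t
      rw [Complex.mul_conj, Complex.normSq_eq_norm_sq]; push_cast; ring
    rw [e, intervalIntegral.integral_ofReal] at h0
    have h0' : ∫ t in (0:ℝ)..1, ‖deriv γ t‖ * ‖d (γ t)‖^2 = 0 := by exact_mod_cast h0
    have h2 : ∀ t ∈ Icc (0:ℝ) 1, d (γ t) = 0 := by
      by_contra hcon
      push Not at hcon
      obtain ⟨t, ht, hne⟩ := hcon
      have hp := intervalIntegral.integral_pos (f := fun t => ‖deriv γ t‖ * ‖d (γ t)‖^2) (a := 0) (b := 1)
        one_pos (hdc.norm.mul (hc.norm.pow 2)).continuousOn (fun x _ => by positivity) ⟨t, ht, by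
          have := norm_pos_iff.2 (D.reg.der t)
          have := norm_pos_iff.2 hne
          positivity⟩
      linarith
    intro t
    have := h2 (Int.fract t) ⟨Int.fract_nonneg t, (Int.fract_lt_one t).le⟩
    have e2 : γ t = γ (Int.fract t) := by
      conv_lhs => rw [← Int.fract_add_floor t]
      exact D.reg.eval_add _ _
    rw [e2]; exact this
  have := Complex.eqOn_closure_of_eqOn_frontier D.bdd hd (diffContOnCl_const (c := (0:ℂ)))
    (fun z hz => by
      rw [D.bdry] at hz
      obtain ⟨t, rfl⟩ := hz
      exact h1 t)
  exact fun z hz => this hz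

def szN (S : ℂ → ℂ → ℂ) (a : ℂ) : ℝ := (S a a).re

def szρ (S : ℂ → ℂ → ℂ) (γ : ℝ → ℂ) (a : ℂ) (t : ℝ) : ℝ := ‖deriv γ t‖ * ‖S (γ t) a‖^2 / szN S a

lemma szN_facts (D : Dom Ω γ) (hS : IsSzegoKernel Ω S) (ha : a ∈ Ω) :
    S a a = szN S a ∧ 0 < szN S a := by
  have hd := szego_diffCont hS ha
  have hr := szego_repr D hS ha hd
  have hc := D.bd_cont hd.continuousOn
  have hdc := D.reg.dcont
  have e : (fun t => (‖deriv γ t‖ : ℂ) * (S (γ t) a * conj (S (γ t) a))) =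
      fun t => ((‖deriv γ t‖ * ‖S (γ t) a‖^2 : ℝ) : ℂ) := by
    funext t
    rw [Complex.mul_conj, Complex.normSq_eq_norm_sq]; push_cast; ring
  have hr' := hr
  simp only [e] at hr
  rw [intervalIntegral.integral_ofReal] at hr
  have h1 : szN S a = ∫ t in (0:ℝ)..1, ‖deriv γ t‖ * ‖S (γ t) a‖^2 := by
    unfold szN; rw [← hr, ofReal_re]
  have h2 : S a a = szN S a := by rw [h1, hr]
  refine ⟨h2, lt_of_le_of_ne ?_ fun h0 => ?_⟩
  · rw [h1]
    exact intervalIntegral.integral_nonneg (by norm_num) fun t _ => by positivity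
  · have h3 := szego_unique D hd (by rw [hr', h2, ← h0]; simp)
    have h4 := szego_repr D hS ha (diffContOnCl_const (c := (1:ℂ)))
    simp only [h3 _ (D.mem_closure _)] at h4
    simp at h4

lemma szρ_repr (D : Dom Ω γ) (hS : IsSzegoKernel Ω S) (ha : a ∈ Ω) {g : ℂ → ℂ}
    (hg : DiffContOnCl ℂ g Ω) : ∫ t in (0:ℝ)..1, (szρ S γ a t : ℂ) * g (γ t) = g a := by
  obtain ⟨h1, h2⟩ := szN_facts D hS ha
  have hN : (szN S a : ℂ) ≠ 0 := by exact_mod_cast h2.ne'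
  have hr := szego_repr D hS ha ((szego_diffCont hS ha).smul hg)
  have e : (fun t => (szρ S γ a t : ℂ) * g (γ t)) = fun t =>
     (1 / (szN S a : ℂ)) * ((‖deriv γ t‖ : ℂ) * (((fun z => S z a) • g) (γ t) * conj (S (γ t) a))) := by
    funext t
    have : ((‖S (γ t) a‖^2 : ℝ) : ℂ) = S (γ t) a * conj (S (γ t) a) := by
      rw [Complex.mul_conj, Complex.normSq_eq_norm_sq]
    unfold szρ
    push_cast at this ⊢
    rw [this]
    simp only [Pi.smul_apply', smul_eq_mul]
    field_simp
  rw [e, intervalIntegral.integral_const_mul]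
  erw [hr]
  simp only [smul_eq_mul, h1]
  field_simp

lemma szRep (D : Dom Ω γ) (hS : IsSzegoKernel Ω S) (ha : a ∈ Ω) : RepDensity Ω γ a (szρ S γ a) := by
  obtain ⟨h1, h2⟩ := szN_facts D hS ha
  have hc := D.bd_cont (szego_diffCont hS ha).continuousOn
  have hdc := D.reg.dcont
  refine ⟨ha, ?_, fun t => ?_, fun t => ?_, ?_, fun z hz => ?_⟩
  · unfold szρ; exact (hdc.norm.mul (hc.norm.pow 2)).div_const _
  · unfold szρ
    rw [D.reg.per, D.reg.dper]
  · unfold szρ; positivity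
  · have := szρ_repr D hS ha (diffContOnCl_const (c := (1:ℂ)))
    simp only [mul_one] at this
    rw [intervalIntegral.integral_ofReal] at this
    exact_mod_cast this
  · have hne : ∀ w ∈ closure Ω, z - w ≠ 0 := fun w hw h0 => hz (by rwa [sub_eq_zero.1 h0])
    have hg : DiffContOnCl ℂ (fun w => 1 / (z - w)) Ω := by
      constructor
      · exact fun w hw => DifferentiableAt.differentiableWithinAt
          ((differentiableAt_const _).div ((differentiableAt_const _).sub differentiableAt_id)
            (hne w (subset_closure hw)))
      · exact continuousOn_const.div (by fun_prop) hne
    have := szρ_repr D hS ha hg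
    simpa only [mul_one_div] using this

lemma szMap (D : Dom Ω γ) (hS : IsSzegoKernel Ω S) (ha : a ∈ Ω) : ∃ F, RMap Ω γ a (szρ S γ a) F :=
  exists_RMap D (szRep D hS ha)

variable {F : ℂ → ℂ}

lemma RMap.dc (R : RMap Ω γ a ρ F) : DiffContOnCl ℂ F Ω := ⟨R.diff, R.cont⟩

lemma RMap.cl_ne (D : Dom Ω γ) (R : RMap Ω γ a ρ F) {z : ℂ} (hz : z ∈ closure Ω) (hza : z ≠ a) : F z ≠ 0 := by
  by_cases h : z ∈ Ω
  · exact R.nz z h hza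
  · have hxf : z ∈ frontier Ω := ⟨hz, by rwa [D.op.interior_eq]⟩
    rw [D.bdry] at hxf
    obtain ⟨t, rfl⟩ := hxf
    have := R.bd t
    intro h0; rw [h0, norm_zero] at this; exact zero_ne_one this

lemma dslope_dc (D : Dom Ω γ) (ha : a ∈ Ω) {h : ℂ → ℂ} (hh : DiffContOnCl ℂ h Ω) :
    DiffContOnCl ℂ (dslope h a) Ω := by
  have hn := D.op.mem_nhds ha
  refine ⟨(Complex.differentiableOn_dslope hn).2 hh.differentiableOn, ?_⟩
  exact (continuousOn_dslope (mem_of_superset hn subset_closure)).2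
    ⟨hh.continuousOn, (hh.differentiableOn a ha).differentiableAt hn⟩

lemma div_dc {f g : ℂ → ℂ} (hf : DiffContOnCl ℂ f Ω) (hg : DiffContOnCl ℂ g Ω)
    (h0 : ∀ z ∈ closure Ω, g z ≠ 0) : DiffContOnCl ℂ (fun z => f z / g z) Ω :=
  ⟨hf.differentiableOn.div hg.differentiableOn fun z hz => h0 z (subset_closure hz),
    hf.continuousOn.div hg.continuousOn h0⟩

lemma mul_dc {f g : ℂ → ℂ} (hf : DiffContOnCl ℂ f Ω) (hg : DiffContOnCl ℂ g Ω) :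
    DiffContOnCl ℂ (fun z => f z * g z) Ω :=
  ⟨hf.differentiableOn.mul hg.differentiableOn, hf.continuousOn.mul hg.continuousOn⟩

lemma RMap.divide (D : Dom Ω γ) (ha : a ∈ Ω) (R : RMap Ω γ a ρ F) {h : ℂ → ℂ} (hh : DiffContOnCl ℂ h Ω)
    (h0 : h a = 0) : ∃ k, DiffContOnCl ℂ k Ω ∧ ∀ z ∈ closure Ω, h z = F z * k z := by
  have hF : ∀ z, (z - a) * dslope F a z = F z := fun z => by
    have := sub_smul_dslope F a z
    rw [R.zero, sub_zero] at this; exact this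
  have hH : ∀ z, (z - a) * dslope h a z = h z := fun z => by
    have := sub_smul_dslope h a z
    rw [h0, sub_zero] at this; exact this
  have hne : ∀ z ∈ closure Ω, dslope F a z ≠ 0 := by
    intro z hz hz0
    by_cases hza : z = a
    · rw [hza, dslope_same] at hz0; exact R.dz hz0
    · have := R.cl_ne D hz hza
      rw [← hF z, hz0, mul_zero] at this; exact this rfl
  refine ⟨fun z => dslope h a z / dslope F a z, div_dc (dslope_dc D ha hh) (dslope_dc D ha R.dc) hne, fun z hz => ?_⟩
  have := hne z hz
  rw [← hF z, ← hH z]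
  field_simp

lemma szego_K (D : Dom Ω γ) (hS : IsSzegoKernel Ω S) (ha : a ∈ Ω) (R : RMap Ω γ a ρ F)
    {w : ℂ} (hw : w ∈ Ω) {z : ℂ} (hz : z ∈ closure Ω) :
    S z w * (1 - F z * conj (F w)) = S z a * conj (S w a) / szN S a := by
  obtain ⟨h1, h2⟩ := szN_facts D hS ha
  have hN : (szN S a : ℂ) ≠ 0 := by exact_mod_cast h2.ne'
  have hs := szego_diffCont hS ha
  have hsw := szego_diffCont hS hw
  set N : ℂ := (szN S a : ℂ) with hNdef
  set d : ℂ → ℂ := fun z => S z w * (1 - F z * conj (F w)) - S z a * (conj (S w a) / N) with hd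
  have hddc : DiffContOnCl ℂ d Ω :=
    (mul_dc hsw ((diffContOnCl_const (c := (1:ℂ))).sub (mul_dc R.dc diffContOnCl_const))).sub
      (mul_dc hs diffContOnCl_const)
  have key : ∀ h : ℂ → ℂ, DiffContOnCl ℂ h Ω →
      ∫ t in (0:ℝ)..1, (‖deriv γ t‖ : ℂ) * (h (γ t) * conj (d (γ t))) = 0 := by
    intro h hh
    have hdcon := D.reg.dcont
    have c1 := D.bd_cont hh.continuousOn
    have c2 := D.bd_cont hs.continuousOn
    have c3 := D.bd_cont hsw.continuousOn
    have c4 := D.bd_cont R.cont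
    obtain ⟨k, hk, hke⟩ := R.divide D ha (h := fun z => h z - S z a * (h a / N))
      (hh.sub (mul_dc hs diffContOnCl_const)) (by simp only [h1]; field_simp; simp)
    have c5 := D.bd_cont hk.continuousOn
    have i1 := szego_repr D hS hw hh
    have i2 := szego_repr D hS ha hh
    have i3 := szego_repr D hS hw hk
    have i4 := szego_repr D hS ha (mul_dc R.dc hsw)
    rw [R.zero, zero_mul] at i4
    have i5 : ∫ t in (0:ℝ)..1, (‖deriv γ t‖ : ℂ) * (conj (F (γ t)) * conj (S (γ t) w) * S (γ t) a) = 0 := by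
      have := congrArg conj i4
      rw [map_zero, ← intervalIntegral.intervalIntegral_conj] at this
      rw [← this]
      congr 1; funext t
      simp
    have e : (fun t => (‖deriv γ t‖ : ℂ) * (h (γ t) * conj (d (γ t)))) = fun t =>
        (((‖deriv γ t‖ : ℂ) * (h (γ t) * conj (S (γ t) w)) -
        F w * ((‖deriv γ t‖ : ℂ) * (k (γ t) * conj (S (γ t) w)))) -
        F w * (h a / N) * ((‖deriv γ t‖ : ℂ) * (conj (F (γ t)) * conj (S (γ t) w) * S (γ t) a))) -
        S w a / N * ((‖deriv γ t‖ : ℂ) * (h (γ t) * conj (S (γ t) a))) := by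
      funext t
      have b1 : conj (F (γ t)) * F (γ t) = 1 := by
        rw [mul_comm, Complex.mul_conj, Complex.normSq_eq_norm_sq, R.bd t]; simp
      have b2 : conj (F (γ t)) * h (γ t) = k (γ t) + conj (F (γ t)) * S (γ t) a * (h a / N) := by
        have := hke (γ t) (D.mem_closure t)
        have h3 : h (γ t) = F (γ t) * k (γ t) + S (γ t) a * (h a / N) := by rw [← this]; ring
        rw [h3, mul_add, ← mul_assoc, b1]; ring
      simp only [hd, map_sub, map_mul, map_one, map_div₀, conj_conj, hNdef, conj_ofReal]
      rw [← hNdef]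
      linear_combination (-(‖deriv γ t‖ : ℂ) * conj (S (γ t) w) * F w) * b2
    have q0 : Continuous (fun t => (‖deriv γ t‖ : ℂ)) := continuous_ofReal.comp hdcon.norm
    have k1 := q0.mul (c1.mul (continuous_conj.comp c3))
    have k2 := (q0.mul (c5.mul (continuous_conj.comp c3))).const_mul (F w)
    have k3 := (q0.mul (((continuous_conj.comp c4).mul (continuous_conj.comp c3)).mul c2)).const_mul (F w * (h a / N))
    have k4 := (q0.mul (c1.mul (continuous_conj.comp c2))).const_mul (S w a / N)
    rw [e, intervalIntegral.integral_sub, intervalIntegral.integral_sub, intervalIntegral.integral_sub,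
      intervalIntegral.integral_const_mul, intervalIntegral.integral_const_mul,
      intervalIntegral.integral_const_mul, i1, i2, i3, i5]
    · have := hke w (subset_closure hw)
      rw [← this]; ring
    all_goals refine Continuous.intervalIntegrable ?_ _ _
    · exact k1
    · exact k2
    · exact k1.sub k2
    · exact k3
    · exact (k1.sub k2).sub k3
    · exact k4
  have := szego_unique D hddc (key d hddc) z hz
  simp only [hd] at this
  rw [sub_eq_zero] at this
  rw [this]; ring

end

section
variable {Ω : Set ℂ} {γ : ℝ → ℂ} {a b : ℂ} {ρ ρ' : ℝ → ℝ} {S : ℂ → ℂ → ℂ} {F G : ℂ → ℂ}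

lemma Dom.max_le (D : Dom Ω γ) {k : ℂ → ℂ} (hk : DiffContOnCl ℂ k Ω) {c : ℝ}
    (hb : ∀ t, ‖k (γ t)‖ ≤ c) {z : ℂ} (hz : z ∈ closure Ω) : ‖k z‖ ≤ c :=
  Complex.norm_le_of_forall_mem_frontier_norm_le D.bdd hk (fun w hw => by
    rw [D.bdry] at hw
    obtain ⟨t, rfl⟩ := hw
    exact hb t) hz

lemma Dom.max_const (D : Dom Ω γ) {k : ℂ → ℂ} (hk : DiffContOnCl ℂ k Ω) {c : ℝ}
    (hb : ∀ t, ‖k (γ t)‖ ≤ c) {z : ℂ} (hz : z ∈ Ω) (he : ‖k z‖ = c) : ∀ w ∈ closure Ω, k w = k z := by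
  have h1 : EqOn k (Function.const ℂ (k z)) Ω :=
    Complex.eqOn_of_isPreconnected_of_isMaxOn_norm D.conn.isPreconnected D.op hk.differentiableOn hz
      (fun w hw => by
        simp only [mem_ofPred_eq, Function.comp_apply, he]
        exact D.max_le hk hb (subset_closure hw))
  exact h1.of_subset_closure hk.continuousOn continuousOn_const subset_closure subset_rfl

lemma Dom.cl_cases (D : Dom Ω γ) {z : ℂ} (hz : z ∈ closure Ω) : z ∈ Ω ∨ ∃ t, z = γ t := by
  by_cases h : z ∈ Ω
  · exact Or.inl h
  · right
    have hxf : z ∈ frontier Ω := ⟨hz, by rwa [D.op.interior_eq]⟩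
    rw [D.bdry] at hxf
    obtain ⟨t, rfl⟩ := hxf
    exact ⟨t, rfl⟩

lemma Dom.unimod_const (D : Dom Ω γ) {k : ℂ → ℂ} (hk : DiffContOnCl ℂ k Ω) {c : ℝ} (hc : 0 < c)
    (hb : ∀ t, ‖k (γ t)‖ = c) (h0 : ∀ z ∈ Ω, k z ≠ 0) :
    ∃ κ : ℂ, κ ≠ 0 ∧ ∀ w ∈ closure Ω, k w = κ := by
  obtain ⟨z, hz⟩ := D.conn.nonempty
  have h0' : ∀ z ∈ closure Ω, k z ≠ 0 := by
    intro z hz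
    rcases D.cl_cases hz with h | ⟨t, rfl⟩
    · exact h0 z h
    · exact norm_pos_iff.1 (by rw [hb t]; exact hc)
  have h1 := D.max_le hk (fun t => (hb t).le) (subset_closure hz)
  have hki : DiffContOnCl ℂ (fun z => 1 / k z) Ω := div_dc diffContOnCl_const hk h0'
  have h2 := D.max_le hki (c := 1/c) (fun t => by rw [norm_div, hb t, norm_one]) (subset_closure hz)
  rw [norm_div, norm_one] at h2
  have h3 := (one_div_le_one_div (norm_pos_iff.2 (h0 z hz)) hc).1 h2
  exact ⟨k z, h0 z hz, D.max_const hk (fun t => (hb t).le) hz (le_antisymm h1 h3)⟩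

lemma RMap.lt_one (D : Dom Ω γ) (ha : a ∈ Ω) (R : RMap Ω γ a ρ F) {z : ℂ} (hz : z ∈ Ω) : ‖F z‖ < 1 := by
  refine lt_of_le_of_ne (D.max_le R.dc (fun t => (R.bd t).le) (subset_closure hz)) fun h => ?_
  have := D.max_const R.dc (fun t => (R.bd t).le) hz h a (subset_closure ha)
  rw [R.zero] at this
  rw [← this, norm_zero] at h
  exact zero_ne_one h

lemma RMap.le_one (D : Dom Ω γ) (R : RMap Ω γ a ρ F) {z : ℂ} (hz : z ∈ closure Ω) : ‖F z‖ ≤ 1 :=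
  D.max_le R.dc (fun t => (R.bd t).le) hz

lemma one_sub_ne {w u : ℂ} (hw : ‖w‖ < 1) (hu : ‖u‖ ≤ 1) : 1 - conj w * u ≠ 0 := by
  intro h
  have h1 : conj w * u = 1 := (sub_eq_zero.1 h).symm
  have h2 : ‖conj w * u‖ = 1 := by rw [h1, norm_one]
  rw [norm_mul, RCLike.norm_conj] at h2
  nlinarith [norm_nonneg u, norm_nonneg w]

lemma mob_norm {w u : ℂ} (hw : ‖w‖ < 1) (hu : ‖u‖ = 1) : ‖(u - w) / (1 - conj w * u)‖ = 1 := by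
  have hne := one_sub_ne hw hu.le
  rw [norm_div, div_eq_one_iff_eq (norm_ne_zero_iff.2 hne)]
  have h1 : u * conj u = 1 := by rw [Complex.mul_conj, Complex.normSq_eq_norm_sq, hu]; simp
  have h2 : 1 - conj w * u = u * conj (u - w) := by
    rw [map_sub, mul_sub, h1]; ring
  rw [h2, norm_mul, hu, one_mul, RCLike.norm_conj]

lemma RMap.mob_dc {f : ℂ → ℂ} (hf : DiffContOnCl ℂ f Ω) (hb : ∀ z ∈ closure Ω, ‖f z‖ ≤ 1) {w : ℂ} (hw : ‖w‖ < 1) :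
    DiffContOnCl ℂ (fun z => (f z - w) / (1 - conj w * f z)) Ω :=
  div_dc (hf.sub diffContOnCl_const) (diffContOnCl_const.sub (mul_dc diffContOnCl_const hf))
    fun z hz => one_sub_ne hw (hb z hz)

lemma RMap.lind_aux (D : Dom Ω γ) (ha : a ∈ Ω) (hb : b ∈ Ω) (R : RMap Ω γ a ρ F) (R' : RMap Ω γ b ρ' G) :
    ∃ k, DiffContOnCl ℂ k Ω ∧ (∀ t, ‖k (γ t)‖ = 1) ∧
      (∀ z ∈ closure Ω, F z - F b = G z * k z * (1 - conj (F b) * F z)) ∧ ‖F b‖ = ‖G a‖ * ‖k a‖ := by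
  have hw := R.lt_one D ha hb
  have hB := RMap.mob_dc R.dc (fun z hz => R.le_one D hz) hw
  obtain ⟨k, hk, hke⟩ := R'.divide D hb hB (by simp)
  have he : ∀ z ∈ closure Ω, F z - F b = G z * k z * (1 - conj (F b) * F z) := by
    intro z hz
    have h1 := one_sub_ne hw (R.le_one D hz)
    have := hke z hz
    rw [← this, div_mul_cancel₀ _ h1]
  refine ⟨k, hk, fun t => ?_, he, ?_⟩
  · have h1 := mob_norm hw (R.bd t)
    have h2 := hke (γ t) (D.mem_closure t)
    rw [h2, norm_mul, R'.bd t, one_mul] at h1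
    exact h1
  · have := he a (subset_closure ha)
    rw [R.zero] at this
    rw [← norm_mul]
    have h3 : F b = - (G a * k a) := by linear_combination -this
    rw [h3, norm_neg]

lemma RMap.lind (D : Dom Ω γ) (ha : a ∈ Ω) (hb : b ∈ Ω) (hab : b ≠ a)
    (R : RMap Ω γ a ρ F) (R' : RMap Ω γ b ρ' G) :
    ∃ κ : ℂ, κ ≠ 0 ∧ ∀ z ∈ closure Ω, F z - F b = G z * κ * (1 - conj (F b) * F z) := by
  obtain ⟨k, hk, hkb, hke, hkn⟩ := RMap.lind_aux D ha hb R R'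
  obtain ⟨k', hk', hkb', hke', hkn'⟩ := RMap.lind_aux D hb ha R' R
  have h1 := D.max_le hk (fun t => (hkb t).le) (subset_closure ha)
  have h2 := D.max_le hk' (fun t => (hkb' t).le) (subset_closure hb)
  have hF := norm_pos_iff.2 (R.nz b hb hab)
  have hG := norm_pos_iff.2 (R'.nz a ha hab.symm)
  have h3 : ‖k a‖ = 1 := by
    refine le_antisymm h1 ?_
    have h4 : ‖G a‖ ≤ ‖F b‖ := by rw [hkn']; exact mul_le_of_le_one_right hF.le h2
    rw [hkn] at h4
    by_contra hlt
    push Not at hlt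
    nlinarith
  have h5 := D.max_const hk (fun t => (hkb t).le) ha h3
  refine ⟨k a, norm_pos_iff.1 (by rw [h3]; exact one_pos), fun z hz => ?_⟩
  rw [hke z hz, h5 z hz]

lemma RMap.injOn (D : Dom Ω γ) (hS : IsSzegoKernel Ω S) (ha : a ∈ Ω) (R : RMap Ω γ a ρ F) : InjOn F Ω := by
  intro z hz b hb he
  by_cases hab : b = a
  · by_contra hne
    rw [hab] at hne he
    exact R.nz z hz hne (by rw [he, R.zero])
  obtain ⟨G, R'⟩ := szMap D hS hb
  obtain ⟨κ, hκ, hk⟩ := RMap.lind D ha hb hab R R'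
  by_contra hne
  have := hk z (subset_closure hz)
  rw [he, sub_self] at this
  have hw := R.lt_one D ha hb
  exact mul_ne_zero (mul_ne_zero (R'.nz z hz hne) hκ) (one_sub_ne hw hw.le) this.symm

lemma RMap.hasDeriv (D : Dom Ω γ) (R : RMap Ω γ a ρ F) {z : ℂ} (hz : z ∈ Ω) : HasDerivAt F (deriv F z) z :=
  ((R.diff z hz).differentiableAt (D.op.mem_nhds hz)).hasDerivAt

lemma RMap.deriv_ne (D : Dom Ω γ) (hS : IsSzegoKernel Ω S) (ha : a ∈ Ω) (R : RMap Ω γ a ρ F) (hb : b ∈ Ω) :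
    deriv F b ≠ 0 := by
  by_cases hab : b = a
  · rw [hab]; exact R.dz
  obtain ⟨G, R'⟩ := szMap D hS hb
  obtain ⟨κ, hκ, hk⟩ := RMap.lind D ha hb hab R R'
  have hw := R.lt_one D ha hb
  have h1 := R.hasDeriv D hb
  have h2 := R'.hasDeriv D hb
  have h3 := (h2.mul_const κ).mul ((h1.const_mul (conj (F b))).const_sub 1)
  have h4 : deriv F b = deriv G b * κ * (1 - conj (F b) * F b) := by
    have h5 : HasDerivAt (fun z => F z - F b) (deriv F b) b := h1.sub_const _
    have h6 := h5.unique (h3.congr_of_eventuallyEq (by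
      filter_upwards [D.op.mem_nhds hb] with z hz
      exact hk z (subset_closure hz)))
    rw [h6, R'.zero]; ring
  rw [h4]
  exact mul_ne_zero (mul_ne_zero R'.dz hκ) (one_sub_ne hw hw.le)

lemma RMap.image (D : Dom Ω γ) (hS : IsSzegoKernel Ω S) (ha : a ∈ Ω) (R : RMap Ω γ a ρ F) :
    F '' Ω = ball 0 1 := by
  apply Subset.antisymm
  · rintro _ ⟨z, hz, rfl⟩
    rw [mem_ball_zero_iff]; exact R.lt_one D ha hz
  · have hopen : IsOpen (F '' Ω) := by
      rw [isOpen_iff_mem_nhds]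
      rintro _ ⟨z, hz, rfl⟩
      have han : AnalyticAt ℂ F z := R.diff.analyticAt (D.op.mem_nhds hz)
      have := han.hasStrictDerivAt.map_nhds_eq (R.deriv_ne D hS ha hz)
      rw [← this]
      exact image_mem_map (D.op.mem_nhds hz)
    refine (convex_ball (0:ℂ) 1).isPreconnected.subset_of_closure_inter_subset hopen
      ⟨0, mem_ball_self one_pos, a, ha, R.zero⟩ ?_
    rintro w ⟨hw, hwb⟩
    have hcomp : IsCompact (F '' closure Ω) := (D.bdd.isCompact_closure).image_of_continuousOn R.cont
    have hw2 : w ∈ F '' closure Ω :=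
      closure_minimal (image_mono subset_closure) hcomp.isClosed hw
    obtain ⟨z, hz, rfl⟩ := hw2
    rcases D.cl_cases hz with h | ⟨t, rfl⟩
    · exact ⟨z, h, rfl⟩
    · rw [mem_ball_zero_iff, R.bd t] at hwb
      exact absurd hwb (lt_irrefl _)

end

section
variable {Ω : Set ℂ} {γ : ℝ → ℂ} {a b : ℂ} {ρ ρ' : ℝ → ℝ} {S : ℂ → ℂ → ℂ} {F G : ℂ → ℂ}

/-- Hopf-type lemma -/
lemma bdry_deriv_ne (D : Dom Ω γ) {g : ℂ → ℂ} (t : ℝ) (hg : AnalyticAt ℂ g (γ t)) (h0 : g (γ t) = 0)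
    (hre : ∀ z ∈ Ω, (g z).re ≤ 0) (hnz : ¬ ∀ᶠ z in nhds (γ t), g z = 0) : deriv g (γ t) ≠ 0 := by
  intro hd
  obtain ⟨k, h, hh, hhb, hev⟩ := hg.exists_eventuallyEq_pow_smul_nonzero_iff.2 hnz
  have hgd : HasDerivAt g 0 (γ t) := by rw [← hd]; exact hg.differentiableAt.hasDerivAt
  have hk : 2 ≤ k := by
    by_contra hlt
    have hk01 : k = 0 ∨ k = 1 := by omega
    rcases hk01 with rfl | rfl
    · have := hev.self_of_nhds
      rw [h0] at this
      simp at this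
      exact hhb this.symm
    · have h1 : HasDerivAt (fun z => (z - γ t)^1 • h z) (h (γ t)) (γ t) := by
        have := ((hasDerivAt_id (γ t)).sub_const (γ t)).mul hh.differentiableAt.hasDerivAt
        simp only [id, sub_self, zero_mul, add_zero, one_mul] at this
        exact this.congr_of_eventuallyEq (Eventually.of_forall fun z => by simp)
      have h2 := hgd.unique (h1.congr_of_eventuallyEq hev)
      exact hhb h2.symm
  have hγ := D.reg.der t
  have hk0 : (k:ℝ) ≠ 0 := by
    have : k ≠ 0 := by omega
    exact_mod_cast this
  set A : ℂ := (I * deriv γ t)^k * h (γ t) with hA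
  have hA0 : A ≠ 0 := mul_ne_zero (pow_ne_zero _ (mul_ne_zero I_ne_zero hγ)) hhb
  set θ : ℝ := -(2/3) * A.arg / k with hθ
  set v : ℂ := I * deriv γ t * exp (θ * I) with hv
  have harg := abs_le.1 (Complex.abs_arg_le_pi A)
  have hpi := Real.pi_pos
  have hcos : 0 < Real.cos θ := by
    have hk2 : (2:ℝ) ≤ k := by exact_mod_cast hk
    have hth : |θ| ≤ Real.pi / 3 := by
      rw [hθ, abs_div, abs_mul, abs_neg, abs_of_pos (show (0:ℝ) < 2/3 by norm_num),
        abs_of_pos (show (0:ℝ) < k by linarith), div_le_iff₀ (by linarith)]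
      have := Complex.abs_arg_le_pi A
      nlinarith
    have := abs_le.1 hth
    exact Real.cos_pos_of_mem_Ioo ⟨by linarith, by linarith⟩
  have him : 0 < (v / deriv γ t).im := by
    have : v / deriv γ t = I * exp (θ * I) := by rw [hv]; field_simp
    rw [this, Complex.exp_mul_I]
    simp [← Complex.ofReal_cos, ← Complex.ofReal_sin]
    exact hcos
  obtain ⟨ε0, hε0, hcone⟩ := D.cone t v him
  have hval : v^k * h (γ t) = ‖A‖ * exp ((A.arg / 3 : ℝ) * I) := by
    have e1 : v^k * h (γ t) = A * exp ((k:ℂ) * (θ * I)) := by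
      rw [hv, mul_pow, ← Complex.exp_nat_mul, hA]; ring
    rw [e1]
    nth_rewrite 1 [← Complex.norm_mul_exp_arg_mul_I A]
    rw [mul_assoc, ← Complex.exp_add]
    congr 2
    have hk0' : (k:ℂ) ≠ 0 := by exact_mod_cast hk0
    rw [hθ]; push_cast
    field_simp
    ring
  have hpos : 0 < (v^k * h (γ t)).re := by
    rw [hval, re_ofReal_mul, Complex.exp_ofReal_mul_I_re]
    exact mul_pos (norm_pos_iff.2 hA0) (Real.cos_pos_of_mem_Ioo ⟨by linarith, by linarith⟩)
  have hcurve : Tendsto (fun ε : ℝ => γ t + ε * v) (nhdsWithin 0 (Ioi 0)) (nhds (γ t)) := by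
    have hc : Continuous (fun ε : ℝ => γ t + ε * v) := by fun_prop
    simpa using (hc.tendsto 0).mono_left (nhdsWithin_le_nhds (s := Ioi 0))
  have hl : Tendsto (fun ε : ℝ => (v^k * h (γ t + ε * v)).re) (nhdsWithin 0 (Ioi 0))
      (nhds (v^k * h (γ t)).re) :=
    (continuous_re.tendsto _).comp ((hh.continuousAt.tendsto.comp hcurve).const_mul (v^k))
  have hle : ∀ᶠ ε : ℝ in nhdsWithin 0 (Ioi 0), (v^k * h (γ t + ε * v)).re ≤ 0 := by
    filter_upwards [Ioo_mem_nhdsGT hε0, hcurve.eventually hev] with ε hε he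
    have h1 := hre _ (hcone ε hε.1 hε.2)
    rw [he] at h1
    have e2 : (γ t + ε * v - γ t)^k • h (γ t + ε * v) = ((ε^k : ℝ) : ℂ) * (v^k * h (γ t + ε * v)) := by
      push_cast
      rw [smul_eq_mul]; ring
    rw [e2, re_ofReal_mul] at h1
    have h2 : 0 < ε^k := pow_pos hε.1 k
    by_contra hlt
    push Not at hlt
    have := mul_pos h2 hlt
    linarith
  have := le_of_tendsto hl hle
  linarith

lemma RMap.bdry_ne (D : Dom Ω γ) (ha : a ∈ Ω) (R : RMap Ω γ a ρ F) {f : ℂ → ℂ}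
    (hf : ∀ z ∈ closure Ω, AnalyticAt ℂ f z) (he : ∀ z ∈ closure Ω, F z = f z) (t : ℝ) :
    deriv f (γ t) ≠ 0 := by
  have hb := D.mem_closure t
  have h1 := R.bd t
  have hu : conj (F (γ t)) * F (γ t) = 1 := by
    rw [mul_comm, Complex.mul_conj, Complex.normSq_eq_norm_sq, h1]; simp
  have hcn : conj (F (γ t)) ≠ 0 := left_ne_zero_of_mul_eq_one hu
  have := bdry_deriv_ne D (g := fun z => conj (F (γ t)) * f z - 1) t
    ((analyticAt_const.mul (hf _ hb)).sub analyticAt_const) (by simp only [← he _ hb, hu, sub_self])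
    (fun z hz => by
      rw [← he z (subset_closure hz), sub_re, one_re]
      have h2 := Complex.re_le_norm (conj (F (γ t)) * F z)
      rw [norm_mul, RCLike.norm_conj, h1, one_mul] at h2
      have := R.lt_one D ha hz
      linarith)
    (fun hev => by
      have hne : NeBot (nhdsWithin (γ t) Ω) := mem_closure_iff_nhdsWithin_neBot.1 hb
      obtain ⟨z, hz, hzΩ⟩ := ((hev.filter_mono nhdsWithin_le_nhds).and
        (self_mem_nhdsWithin (a := γ t) (s := Ω))).exists
      rw [← he z (subset_closure hzΩ), sub_eq_zero] at hz
      have h2 : ‖conj (F (γ t)) * F z‖ = 1 := by rw [hz, norm_one]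
      rw [norm_mul, RCLike.norm_conj, h1, one_mul] at h2
      have := R.lt_one D ha hzΩ
      linarith)
  intro h0
  apply this
  have hd := ((hf _ hb).differentiableAt.hasDerivAt.const_mul (conj (F (γ t)))).sub_const 1
  rw [h0, mul_zero] at hd
  exact hd.deriv

lemma szego_ne (D : Dom Ω γ) (hS : IsSzegoKernel Ω S) (ha : a ∈ Ω) (R : RMap Ω γ a ρ F) {z : ℂ} (hz : z ∈ Ω) :
    S z a ≠ 0 := by
  intro h0
  have hK := szego_K D hS ha R hz (subset_closure hz)
  rw [h0, zero_mul, zero_div] at hK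
  have hw := R.lt_one D ha hz
  have h1 : 1 - F z * conj (F z) ≠ 0 := by rw [mul_comm]; exact one_sub_ne hw hw.le
  obtain ⟨h2, h3⟩ := szN_facts D hS hz
  rw [h2] at hK
  exact mul_ne_zero (by exact_mod_cast h3.ne') h1 hK

lemma RMap.deriv_sq (D : Dom Ω γ) (hS : IsSzegoKernel Ω S) (ha : a ∈ Ω) (R : RMap Ω γ a (szρ S γ a) F) {f : ℂ → ℂ}
    (hf : ∀ z ∈ closure Ω, AnalyticAt ℂ f z) (he : ∀ z ∈ closure Ω, F z = f z) :
    ∃ c : ℂ, c ≠ 0 ∧ ∀ z ∈ Ω, deriv F z = c * (S z a)^2 := by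
  obtain ⟨hN1, hN⟩ := szN_facts D hS ha
  obtain ⟨s0, hs0, hside⟩ := D.side
  have hder : ∀ z ∈ Ω, deriv F z = deriv f z := fun z hz => by
    refine EventuallyEq.deriv_eq ?_
    filter_upwards [D.op.mem_nhds hz] with w hw
    exact he w (subset_closure hw)
  have hnorm : ∀ t, ‖deriv f (γ t)‖ = 2 * Real.pi / szN S a * ‖S (γ t) a‖^2 := by
    intro t
    have h1 : Tendsto (fun s => ‖deriv f (nrm γ t s)‖) (nhdsWithin 0 (Ioi 0)) (nhds ‖deriv f (γ t)‖) :=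
      ((hf _ (D.mem_closure t)).deriv.continuousAt.tendsto.comp (nrm_tendsto D.reg t)).norm
    have h2 := R.lim t
    have h3 := tendsto_nhds_unique (h1.congr' (by
      filter_upwards [Ioo_mem_nhdsGT hs0] with s hs
      rw [hder _ (hside t s hs.1 hs.2.le).1])) h2
    rw [h3]
    unfold szρ
    have := norm_ne_zero_iff.2 (D.reg.der t)
    field_simp
  have hsne : ∀ z ∈ closure Ω, S z a ≠ 0 := by
    intro z hz
    rcases D.cl_cases hz with h | ⟨t, rfl⟩
    · exact szego_ne D hS ha R h
    · intro h0
      have := hnorm t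
      rw [h0] at this
      simp at this
      exact R.bdry_ne D ha hf he t this
  have hs := szego_diffCont hS ha
  have hfd : DiffContOnCl ℂ (deriv f) Ω :=
    ⟨fun z hz => (hf z (subset_closure hz)).deriv.differentiableAt.differentiableWithinAt,
      fun z hz => (hf z hz).deriv.continuousAt.continuousWithinAt⟩
  have hk : DiffContOnCl ℂ (fun z => deriv f z / (S z a * S z a)) Ω :=
    div_dc hfd (mul_dc hs hs) fun z hz => mul_ne_zero (hsne z hz) (hsne z hz)
  obtain ⟨κ, hκ, hke⟩ := D.unimod_const hk (c := 2 * Real.pi / szN S a) (by have := Real.pi_pos; positivity)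
    (fun t => by
      have := norm_ne_zero_iff.2 (hsne _ (D.mem_closure t))
      rw [norm_div, norm_mul, hnorm t]
      field_simp)
    (fun z hz => div_ne_zero (by rw [← hder z hz]; exact R.deriv_ne D hS ha hz)
      (mul_ne_zero (hsne z (subset_closure hz)) (hsne z (subset_closure hz))))
  refine ⟨κ, hκ, fun z hz => ?_⟩
  rw [hder z hz, ← hke z (subset_closure hz)]
  have := hsne z (subset_closure hz)
  field_simp

end

section
variable {Ω : Set ℂ} {γ : ℝ → ℂ} {a b : ℂ} {ρ ρ' : ℝ → ℝ} {S : ℂ → ℂ → ℂ} {F G : ℂ → ℂ}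

/-- a bounded rational function has no poles on the closure -/
lemma rat_bdd (hΩ : IsOpen Ω) {g : ℂ → ℂ} {C : ℝ} (hC : ∀ z ∈ Ω, ‖g z‖ ≤ C) (hg : ContinuousOn g Ω)
    {p q : Polynomial ℂ} (hq : q ≠ 0) (h : ∀ z ∈ Ω, g z * q.eval z = p.eval z) :
    ∃ p' q' : Polynomial ℂ, (∀ z ∈ closure Ω, q'.eval z ≠ 0) ∧ ∀ z ∈ Ω, g z = p'.eval z / q'.eval z := by
  obtain ⟨p', hp'⟩ := EuclideanDomain.gcd_dvd_left p q
  obtain ⟨q', hq'⟩ := EuclideanDomain.gcd_dvd_right p q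
  set d := EuclideanDomain.gcd p q with hd
  have hd0 : d ≠ 0 := by
    intro h0; rw [h0, zero_mul] at hq'; exact hq hq'
  have hcop : IsCoprime p' q' := by
    have hbez := EuclideanDomain.gcd_eq_gcd_ab p q
    refine ⟨EuclideanDomain.gcdA p q, EuclideanDomain.gcdB p q, ?_⟩
    apply mul_left_cancel₀ hd0
    calc d * (EuclideanDomain.gcdA p q * p' + EuclideanDomain.gcdB p q * q')
        = (d * p') * EuclideanDomain.gcdA p q + (d * q') * EuclideanDomain.gcdB p q := by ring
      _ = d * 1 := by rw [← hp', ← hq', mul_one, hd]; exact hbez.symm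
  set T : Set ℂ := {z | d.IsRoot z} with hT
  have hTf : T.Finite := Polynomial.finite_setOfPred_isRoot hd0
  have hTd : Dense Tᶜ := Set.Countable.dense_compl ℂ hTf.countable
  have hsub : Ω ⊆ closure (Ω ∩ Tᶜ) := hTd.open_subset_closure_inter hΩ
  have hcl : closure Ω ⊆ closure (Ω ∩ Tᶜ) := closure_minimal hsub isClosed_closure
  have he : ∀ z ∈ Ω ∩ Tᶜ, g z * q'.eval z = p'.eval z := by
    rintro z ⟨hz, hzT⟩
    have hdz : d.eval z ≠ 0 := hzT
    have h1 := h z hz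
    rw [hp', hq', Polynomial.eval_mul, Polynomial.eval_mul] at h1
    apply mul_left_cancel₀ hdz
    linear_combination h1
  have hle : ∀ z ∈ closure Ω, ‖p'.eval z‖ ≤ C * ‖q'.eval z‖ := by
    have hclosed : IsClosed {z : ℂ | ‖p'.eval z‖ ≤ C * ‖q'.eval z‖} :=
      isClosed_le p'.continuous.norm (continuous_const.mul q'.continuous.norm)
    intro z hz
    refine closure_minimal (t := {z : ℂ | ‖p'.eval z‖ ≤ C * ‖q'.eval z‖}) ?_ hclosed (hcl hz)
    intro w hw
    change ‖p'.eval w‖ ≤ C * ‖q'.eval w‖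
    rw [← he w hw, norm_mul]
    exact mul_le_mul_of_nonneg_right (hC w hw.1) (norm_nonneg _)
  have hne : ∀ z ∈ closure Ω, q'.eval z ≠ 0 := by
    intro z hz h0
    have h1 := hle z hz
    rw [h0, norm_zero, mul_zero] at h1
    have h2 : p'.eval z = 0 := norm_le_zero_iff.1 h1
    obtain ⟨u, v, huv⟩ := hcop
    have := congrArg (Polynomial.eval z) huv
    simp [h0, h2] at this
  refine ⟨p', q', hne, ?_⟩
  have : EqOn (fun z => g z) (fun z => p'.eval z / q'.eval z) Ω := by
    refine Set.EqOn.of_subset_closure (s := Ω ∩ Tᶜ) ?_ hg ?_ inter_subset_left hsub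
    · intro z hz
      exact (eq_div_iff (hne z (subset_closure hz.1))).2 (he z hz)
    · exact p'.continuous.continuousOn.div q'.continuous.continuousOn fun z hz => hne z (subset_closure hz)
  exact this

lemma rat_dc (hΩ : IsOpen Ω) (hbd : Bornology.IsBounded Ω) {g : ℂ → ℂ} (hg : DiffContOnCl ℂ g Ω)
    {p q : Polynomial ℂ} (hq : q ≠ 0) (h : ∀ z ∈ Ω, g z * q.eval z = p.eval z) :
    ∃ p' q' : Polynomial ℂ, (∀ z ∈ closure Ω, q'.eval z ≠ 0) ∧
      ∀ z ∈ closure Ω, g z = p'.eval z / q'.eval z := by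
  obtain ⟨C, hC⟩ := (hbd.isCompact_closure).exists_bound_of_continuousOn hg.continuousOn
  obtain ⟨p', q', h1, h2⟩ := rat_bdd hΩ (fun z hz => hC z (subset_closure hz))
    (hg.continuousOn.mono subset_closure) hq h
  refine ⟨p', q', h1, ?_⟩
  have : EqOn (fun z => g z) (fun z => p'.eval z / q'.eval z) (closure Ω) :=
    Set.EqOn.of_subset_closure (s := Ω) h2 hg.continuousOn
      (p'.continuous.continuousOn.div q'.continuous.continuousOn h1) subset_closure subset_rfl
  exact this

lemma rat_analytic {p q : Polynomial ℂ} {z : ℂ} (h : q.eval z ≠ 0) :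
    AnalyticAt ℂ (fun z => p.eval z / q.eval z) z := by
  have h1 : AnalyticAt ℂ (fun z => p.eval z) z := by
    simpa using AnalyticAt.aeval_polynomial (A := ℂ) (analyticAt_id (𝕜 := ℂ) (z := z)) p
  have h2 : AnalyticAt ℂ (fun z => q.eval z) z := by
    simpa using AnalyticAt.aeval_polynomial (A := ℂ) (analyticAt_id (𝕜 := ℂ) (z := z)) q
  exact h1.div h2 h

def slice (Q : MvPolynomial (Fin 2) ℂ) (w : ℂ) : Polynomial ℂ :=
  MvPolynomial.aeval ![Polynomial.X, Polynomial.C (conj w)] Q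

lemma slice_eval (Q : MvPolynomial (Fin 2) ℂ) (w z : ℂ) :
    (slice Q w).eval z = MvPolynomial.eval ![z, conj w] Q := by
  unfold slice
  rw [← Polynomial.coe_aeval_eq_eval, ← AlgHom.comp_apply, MvPolynomial.comp_aeval,
    ← MvPolynomial.coe_aeval_eq_eval]
  change MvPolynomial.aeval _ Q = MvPolynomial.aeval _ Q
  congr 2
  funext i
  fin_cases i <;> simp

lemma slice_ne {Q : MvPolynomial (Fin 2) ℂ} (hQ : Q ≠ 0) {B : Set ℂ} (hB : B.Infinite) :
    ∃ w ∈ B, slice Q w ≠ 0 := by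
  by_contra! h
  apply hQ
  refine MvPolynomial.funext_set ![univ, conj '' B] ?_ ?_
  · intro i
    fin_cases i
    · exact Set.infinite_univ
    · exact hB.image (RingHom.injective (starRingEnd ℂ)).injOn
  · intro x hx
    have h1 : x 1 ∈ conj '' B := hx 1 (mem_univ _)
    obtain ⟨w, hw, hw1⟩ := h1
    have : x = ![x 0, conj w] := by
      funext i
      fin_cases i
      · rfl
      · exact hw1.symm
    rw [this, ← slice_eval, h w hw]
    simp

lemma Dom.infinite (D : Dom Ω γ) : Ω.Infinite := by
  obtain ⟨z, hz⟩ := D.conn.nonempty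
  exact infinite_of_mem_nhds z (D.op.mem_nhds hz)

lemma dir1 (D : Dom Ω γ) (hS : IsSzegoKernel Ω S) {P Q : MvPolynomial (Fin 2) ℂ} (hQ : Q ≠ 0)
    (h : ∀ z ∈ Ω, ∀ w ∈ Ω,
        S z w * MvPolynomial.eval ![z, conj w] Q = MvPolynomial.eval ![z, conj w] P) :
    ∃ f : ℂ → ℂ, IsRationalBiholoOntoDisc Ω f ∧
      ∃ p q : Polynomial ℂ, (∀ z ∈ Ω, q.eval z ≠ 0) ∧
        ∀ z ∈ Ω, deriv f z = (p.eval z / q.eval z) ^ 2 := by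
  obtain ⟨a, ha, hQa⟩ := slice_ne hQ D.infinite
  obtain ⟨w, ⟨hw, hwa⟩, hQw⟩ := slice_ne hQ (D.infinite.sdiff (finite_singleton a))
  have hwa' : w ≠ a := hwa
  obtain ⟨p1, q1, hq1, hs1⟩ := rat_dc D.op D.bdd (szego_diffCont hS ha) hQa (p := slice P a)
    (fun z hz => by rw [slice_eval, slice_eval]; exact h z hz a ha)
  obtain ⟨p2, q2, hq2, hs2⟩ := rat_dc D.op D.bdd (szego_diffCont hS hw) hQw (p := slice P w)
    (fun z hz => by rw [slice_eval, slice_eval]; exact h z hz w hw)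
  obtain ⟨F, R⟩ := szMap D hS ha
  obtain ⟨hN1, hN⟩ := szN_facts D hS ha
  have hN0 : (szN S a : ℂ) ≠ 0 := by exact_mod_cast hN.ne'
  obtain ⟨hw1, hw2⟩ := szN_facts D hS hw
  have hSww : S w w ≠ 0 := by rw [hw1]; exact_mod_cast hw2.ne'
  have hFw : conj (F w) ≠ 0 := (map_ne_zero _).2 (R.nz w hw hwa')
  have hp2 : p2.eval w ≠ 0 := by
    intro h0
    have := hs2 w (subset_closure hw)
    rw [h0, zero_div] at this
    exact hSww this
  obtain ⟨p, q, hq, hF⟩ := rat_dc D.op D.bdd R.dc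
    (q := Polynomial.C (conj (F w) * szN S a) * p2 * q1)
    (p := Polynomial.C (szN S a : ℂ) * p2 * q1 - Polynomial.C (conj (S w a)) * p1 * q2)
    (by
      intro h0
      have := congrArg (Polynomial.eval w) h0
      simp only [Polynomial.eval_mul, Polynomial.eval_C, Polynomial.eval_zero] at this
      exact mul_ne_zero (mul_ne_zero (mul_ne_zero hFw hN0) hp2) (hq1 w (subset_closure hw)) this)
    (fun z hz => by
      have hz' := subset_closure hz
      have hK := szego_K D hS ha R hw hz'
      have e1 := hq1 z hz'
      have e2 := hq2 z hz'
      have f1 : S z a = p1.eval z / q1.eval z := hs1 z hz'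
      have f2 : S z w = p2.eval z / q2.eval z := hs2 z hz'
      rw [f1, f2] at hK
      simp only [Polynomial.eval_mul, Polynomial.eval_C, Polynomial.eval_sub]
      field_simp at hK
      linear_combination -hK)
  obtain ⟨c, hc, hd⟩ := R.deriv_sq D hS ha (f := fun z => p.eval z / q.eval z)
    (fun z hz => rat_analytic (hq z hz)) hF
  refine ⟨F, ⟨⟨p, q, fun z hz => hq z (subset_closure hz), fun z hz => hF z (subset_closure hz)⟩,
    R.diff, R.injOn D hS ha, R.image D hS ha⟩, ?_⟩
  obtain ⟨e, he⟩ := IsAlgClosed.exists_pow_nat_eq c (n := 2) (by norm_num)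
  refine ⟨Polynomial.C e * p1, q1, fun z hz => hq1 z (subset_closure hz), fun z hz => ?_⟩
  have f1 : S z a = p1.eval z / q1.eval z := hs1 z (subset_closure hz)
  rw [hd z hz, f1, Polynomial.eval_mul, Polynomial.eval_C, ← he]
  ring

end

section
variable {Ω : Set ℂ} {γ : ℝ → ℂ} {a b : ℂ} {ρ ρ' : ℝ → ℝ} {S : ℂ → ℂ → ℂ} {F G : ℂ → ℂ}

lemma ev0 (p : Polynomial ℂ) (z w : ℂ) :
    MvPolynomial.eval ![z, w] (Polynomial.aeval (MvPolynomial.X 0) p : MvPolynomial (Fin 2) ℂ) = p.eval z := by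
  rw [← MvPolynomial.coe_aeval_eq_eval]
  change MvPolynomial.aeval ![z, w] _ = _
  rw [← Polynomial.aeval_algHom_apply]
  simp

lemma ev1 (p : Polynomial ℂ) (z w : ℂ) :
    MvPolynomial.eval ![z, conj w]
      (Polynomial.aeval (MvPolynomial.X 1) (p.map (starRingEnd ℂ)) : MvPolynomial (Fin 2) ℂ) = conj (p.eval w) := by
  rw [← MvPolynomial.coe_aeval_eq_eval]
  change MvPolynomial.aeval ![z, conj w] _ = _
  rw [← Polynomial.aeval_algHom_apply]
  simp [Polynomial.eval_map, Polynomial.eval₂_hom]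

lemma build_PQ (D : Dom Ω γ) (hS : IsSzegoKernel Ω S) (ha : a ∈ Ω) (R : RMap Ω γ a ρ F)
    {p1 q1 p2 q2 : Polynomial ℂ} (hq1 : ∀ z ∈ Ω, q1.eval z ≠ 0) (hs : ∀ z ∈ Ω, S z a = p1.eval z / q1.eval z)
    (hq2 : ∀ z ∈ Ω, q2.eval z ≠ 0) (hF : ∀ z ∈ Ω, F z = p2.eval z / q2.eval z) :
    ∃ P Q : MvPolynomial (Fin 2) ℂ, Q ≠ 0 ∧
      ∀ z ∈ Ω, ∀ w ∈ Ω,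
        S z w * MvPolynomial.eval ![z, conj w] Q = MvPolynomial.eval ![z, conj w] P := by
  obtain ⟨hN1, hN⟩ := szN_facts D hS ha
  have hN0 : (szN S a : ℂ) ≠ 0 := by exact_mod_cast hN.ne'
  let A (p : Polynomial ℂ) : MvPolynomial (Fin 2) ℂ := Polynomial.aeval (MvPolynomial.X 0) p
  let B (p : Polynomial ℂ) : MvPolynomial (Fin 2) ℂ :=
    Polynomial.aeval (MvPolynomial.X 1) (p.map (starRingEnd ℂ))
  have hA : ∀ p z w, MvPolynomial.eval ![z, w] (A p) = p.eval z := ev0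
  have hB : ∀ p z w, MvPolynomial.eval ![z, conj w] (B p) = conj (p.eval w) := ev1
  refine ⟨A p1 * B p1 * A q2 * B q2,
    MvPolynomial.C (szN S a : ℂ) * A q1 * B q1 * (A q2 * B q2 - A p2 * B p2), ?_, ?_⟩
  · intro h0
    have := congrArg (MvPolynomial.eval ![a, conj a]) h0
    have hp2 : p2.eval a = 0 := by
      have := hF a ha
      rw [R.zero, eq_comm, div_eq_zero_iff] at this
      exact this.resolve_right (hq2 a ha)
    simp only [map_mul, map_sub, hA, hB, MvPolynomial.eval_C, map_zero, hp2, zero_mul, sub_zero] at this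
    have e1 := hq1 a ha
    have e2 := hq2 a ha
    have e3 := (map_ne_zero conj).2 e1
    have e4 := (map_ne_zero conj).2 e2
    exact mul_ne_zero (mul_ne_zero (mul_ne_zero hN0 e1) e3) (mul_ne_zero e2 e4) this
  · intro z hz w hw
    have hK := szego_K D hS ha R hw (subset_closure hz)
    simp only [map_mul, map_sub, hA, hB, MvPolynomial.eval_C]
    rw [hs z hz, hs w hw, hF z hz, hF w hw, map_div₀, map_div₀] at hK
    have e1 := hq1 z hz
    have e2 := hq2 z hz
    have e3 := (map_ne_zero conj).2 (hq1 w hw)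
    have e4 := (map_ne_zero conj).2 (hq2 w hw)
    field_simp at hK
    linear_combination hK

lemma biholo_bdry (D : Dom Ω γ) {g : ℂ → ℂ} (hg : ∀ z ∈ closure Ω, AnalyticAt ℂ g z) (hi : InjOn g Ω)
    (him : g '' Ω = ball 0 1) : (∀ z ∈ closure Ω, ‖g z‖ ≤ 1) ∧ ∀ t, ‖g (γ t)‖ = 1 := by
  have hc : ContinuousOn g (closure Ω) := fun z hz => (hg z hz).continuousAt.continuousWithinAt
  have hlt : ∀ z ∈ Ω, ‖g z‖ < 1 := fun z hz => by
    have : g z ∈ ball (0:ℂ) 1 := him ▸ mem_image_of_mem g hz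
    simpa using this
  have hle : ∀ z ∈ closure Ω, ‖g z‖ ≤ 1 := by
    intro z hz
    have h1 : g z ∈ closure (g '' Ω) := by
      exact (hc z hz).mono subset_closure |>.mem_closure_image hz
    have h2 : closure (g '' Ω) ⊆ closedBall 0 1 := by rw [him]; exact closure_ball_subset_closedBall
    simpa using h2 h1
  refine ⟨hle, fun t => ?_⟩
  by_contra hne
  have hlt1 : ‖g (γ t)‖ < 1 := lt_of_le_of_ne (hle _ (D.mem_closure t)) hne
  have hmem : g (γ t) ∈ g '' Ω := by rw [him]; simpa using hlt1
  obtain ⟨z0, hz0, he⟩ := hmem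
  have hz0t : z0 ≠ γ t := fun h => D.notMem t (h ▸ hz0)
  obtain ⟨U, V, hU, hV, hzU, htV, hUV⟩ := t2_separation hz0t
  have hΩ := D.op.mem_nhds hz0
  rcases (hg z0 (subset_closure hz0)).eventually_constant_or_nhds_le_map_nhds with h | h
  · have h1 : ∀ᶠ z in nhds z0, z = z0 := by
      filter_upwards [h, hΩ] with z hz hzΩ
      exact hi hzΩ hz0 hz
    have h2 : ({z0} : Set ℂ) ∈ nhds z0 := h1
    exact (infinite_of_mem_nhds z0 h2) (finite_singleton _)
  · have h1 : g '' (U ∩ Ω) ∈ nhds (g z0) := h (image_mem_map (inter_mem (hU.mem_nhds hzU) hΩ))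
    rw [he] at h1
    have h2 := (hg _ (D.mem_closure t)).continuousAt.preimage_mem_nhds h1
    have h3 := inter_mem h2 (hV.mem_nhds htV)
    obtain ⟨z1, ⟨hz1, hz1V⟩, hz1Ω⟩ := mem_closure_iff_nhds.1 (D.mem_closure t) _ h3
    obtain ⟨u, ⟨huU, huΩ⟩, hu⟩ := hz1
    have := hi huΩ hz1Ω hu
    subst this
    exact Set.disjoint_left.1 hUV huU hz1V

lemma dir2 (D : Dom Ω γ) (hS : IsSzegoKernel Ω S) {f : ℂ → ℂ} (hf : IsRationalBiholoOntoDisc Ω f)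
    {p q : Polynomial ℂ} (hq : ∀ z ∈ Ω, q.eval z ≠ 0) (hr : ∀ z ∈ Ω, deriv f z = (p.eval z / q.eval z) ^ 2) :
    ∃ P Q : MvPolynomial (Fin 2) ℂ, Q ≠ 0 ∧
      ∀ z ∈ Ω, ∀ w ∈ Ω,
        S z w * MvPolynomial.eval ![z, conj w] Q = MvPolynomial.eval ![z, conj w] P := by
  obtain ⟨⟨p0, q0, hq0, hf0⟩, hfd, hfi, hfim⟩ := hf
  obtain ⟨x, hx⟩ := D.conn.nonempty
  have hlt : ∀ z ∈ Ω, ‖f z‖ < 1 := fun z hz => by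
    have : f z ∈ ball (0:ℂ) 1 := hfim ▸ mem_image_of_mem f hz
    simpa using this
  obtain ⟨pf, qf, hqf, hfe⟩ := rat_bdd D.op (C := 1) (fun z hz => (hlt z hz).le) hfd.continuousOn
    (p := p0) (q := q0) (by rintro rfl; exact hq0 x hx (by simp))
    (fun z hz => by rw [hf0 z hz]; exact div_mul_cancel₀ _ (hq0 z hz))
  set g : ℂ → ℂ := fun z => pf.eval z / qf.eval z with hgdef
  have hg : ∀ z ∈ closure Ω, AnalyticAt ℂ g z := fun z hz => rat_analytic (hqf z hz)
  have hfg : EqOn f g Ω := hfe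
  have hgi : InjOn g Ω := hfi.congr hfg
  have hgim : g '' Ω = ball 0 1 := by rw [← hfg.image_eq]; exact hfim
  have hgd : ∀ z ∈ Ω, HasDerivAt g ((p.eval z / q.eval z)^2) z := fun z hz => by
    rw [← hr z hz]
    have h1 : f =ᶠ[nhds z] g := by
      filter_upwards [D.op.mem_nhds hz] with y hy using hfg hy
    rw [h1.deriv_eq]
    exact (hg z (subset_closure hz)).differentiableAt.hasDerivAt
  obtain ⟨hgle, hgb⟩ := biholo_bdry D hg hgi hgim
  have hgdc : DiffContOnCl ℂ g Ω :=
    ⟨fun z hz => (hg z (subset_closure hz)).differentiableAt.differentiableWithinAt,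
      fun z hz => (hg z hz).continuousAt.continuousWithinAt⟩
  obtain ⟨a, ha, hra⟩ : ∃ a ∈ Ω, (p.eval a / q.eval a)^2 ≠ 0 := by
    by_contra! h0
    have h1 : Ω.EqOn (deriv g) 0 := fun z hz => by
      rw [(hgd z hz).deriv, h0 z hz]; rfl
    obtain ⟨C, hC⟩ := D.op.exists_is_const_of_deriv_eq_zero D.conn.isPreconnected hgdc.differentiableOn h1
    have h2 : Ω ⊆ {x} := fun z hz => hgi hz hx (by rw [hC z hz, hC x hx])
    exact D.infinite ((finite_singleton x).subset h2)
  obtain ⟨F, R⟩ := szMap D hS ha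
  set w := g a with hw
  have hwlt : ‖w‖ < 1 := by rw [hw, ← hfg ha]; exact hlt a ha
  have hden : ∀ z ∈ closure Ω, 1 - conj w * g z ≠ 0 := fun z hz => one_sub_ne hwlt (hgle z hz)
  have hm := RMap.mob_dc hgdc hgle hwlt
  set m : ℂ → ℂ := fun z => (g z - w) / (1 - conj w * g z) with hmdef
  have hmd : ∀ z ∈ Ω, HasDerivAt m ((1 - conj w * w) * (p.eval z / q.eval z)^2 / (1 - conj w * g z)^2) z := by
    intro z hz
    have h1 := ((hgd z hz).sub_const w).div (((hgd z hz).const_mul (conj w)).const_sub 1)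
      (hden z (subset_closure hz))
    refine h1.congr_deriv ?_
    congr 1
    ring
  obtain ⟨k, hk, hke⟩ := R.divide D ha hm (by simp [hmdef, hw])
  have hww : 1 - conj w * w ≠ 0 := one_sub_ne hwlt hwlt.le
  have hka : k a ≠ 0 := by
    intro h0
    have h1 : HasDerivAt (fun z => F z * k z) (deriv F a * k a + F a * deriv k a) a :=
      (R.hasDeriv D ha).mul ((hk.differentiableOn a ha).differentiableAt (D.op.mem_nhds ha)).hasDerivAt
    rw [h0, R.zero, mul_zero, zero_mul, add_zero] at h1
    have h2 : m =ᶠ[nhds a] fun z => F z * k z := by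
      filter_upwards [D.op.mem_nhds ha] with y hy using hke y (subset_closure hy)
    have h3 := (hmd a ha).unique (h1.congr_of_eventuallyEq h2)
    exact div_ne_zero (mul_ne_zero hww hra) (pow_ne_zero 2 (hden a (subset_closure ha))) h3
  obtain ⟨κ, hκ, hkc⟩ := D.unimod_const hk one_pos
    (fun t => by
      have h1 := hke _ (D.mem_closure t)
      have h2 := congrArg norm h1
      rw [norm_mul, R.bd t, one_mul] at h2
      rw [← h2]
      exact mob_norm hwlt (hgb t))
    (fun z hz => by
      by_cases hza : z = a
      · rw [hza]; exact hka
      · intro h0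
        have h1 := hke z (subset_closure hz)
        rw [h0, mul_zero] at h1
        have h2 : g z - w = 0 := (div_eq_zero_iff.1 h1).resolve_right (hden z (subset_closure hz))
        exact hza (hgi hz ha (sub_eq_zero.1 h2)))
  have hFm : ∀ z ∈ closure Ω, F z = m z / κ := fun z hz => by
    rw [hke z hz, hkc z hz]; field_simp
  obtain ⟨c, hc, hcd⟩ := R.deriv_sq D hS ha (f := fun z => m z / κ)
    (fun z hz => (((hg z hz).sub analyticAt_const).div
      (analyticAt_const.sub (analyticAt_const.mul (hg z hz))) (hden z hz)).div analyticAt_const hκ) hFm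
  obtain ⟨e, he⟩ := IsAlgClosed.exists_pow_nat_eq ((1 - conj w * w) / (κ * c)) (n := 2) (by norm_num)
  set u : ℂ → ℂ := fun z => e * ((p.eval z / q.eval z) / (1 - conj w * g z)) with hu
  have hsq : ∀ z ∈ Ω, (S z a)^2 = (u z)^2 := by
    intro z hz
    have h1 : HasDerivAt F ((1 - conj w * w) * (p.eval z / q.eval z)^2 / (1 - conj w * g z)^2 / κ) z := by
      refine ((hmd z hz).div_const κ).congr_of_eventuallyEq ?_
      filter_upwards [D.op.mem_nhds hz] with y hy using hFm y (subset_closure hy)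
    have h2 := hcd z hz
    rw [h1.deriv] at h2
    rw [hu]
    simp only
    rw [mul_pow, he, div_pow _ (1 - conj w * g z)]
    have h3 : (S z a)^2 = c * (S z a)^2 / c := by field_simp
    rw [h3, ← h2]
    have := hden z (subset_closure hz)
    field_simp
  have hsne : ∀ z ∈ Ω, S z a ≠ 0 := fun z hz => szego_ne D hS ha R hz
  have hune : ∀ z ∈ Ω, u z ≠ 0 := fun z hz h0 => by
    have := hsq z hz
    rw [h0] at this
    exact hsne z hz (by simpa using this)
  have huc : ContinuousOn u Ω :=
    continuousOn_const.mul ((p.continuous.continuousOn.div q.continuous.continuousOn hq).div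
      (continuousOn_const.sub (continuousOn_const.mul (hgdc.continuousOn.mono subset_closure)))
      fun z hz => hden z (subset_closure hz))
  obtain ⟨e', he'⟩ : ∃ e' : ℂ, ∀ z ∈ Ω, S z a = e' * ((p.eval z / q.eval z) / (1 - conj w * g z)) := by
    rcases D.conn.isPreconnected.eq_or_eq_neg_of_sq_eq (f := fun z => S z a) (g := u)
      ((hS.continuousOn a ha).mono subset_closure) huc (fun z hz => hsq z hz) (fun hz => hune _ hz) with h | h
    · exact ⟨e, fun z hz => h hz⟩
    · refine ⟨-e, fun z hz => ?_⟩
      have := h hz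
      simp only [Pi.neg_apply, hu] at this
      rw [this]; ring
  have hd2 : ∀ z ∈ Ω, qf.eval z - conj w * pf.eval z ≠ 0 := by
    intro z hz h0
    have h1 := hqf z (subset_closure hz)
    apply hden z (subset_closure hz)
    simp only [hgdef]
    field_simp
    linear_combination h0
  refine build_PQ D hS ha R (p1 := Polynomial.C e' * p * qf) (q1 := q * (qf - Polynomial.C (conj w) * pf))
    (p2 := pf - Polynomial.C w * qf) (q2 := Polynomial.C κ * (qf - Polynomial.C (conj w) * pf)) ?_ ?_ ?_ ?_
  · intro z hz
    simpa using ⟨hq z hz, hd2 z hz⟩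
  · intro z hz
    have h1 := hqf z (subset_closure hz)
    have h2 := hd2 z hz
    have h3 := hq z hz
    have h4 : 1 - conj w * g z = (qf.eval z - conj w * pf.eval z) / qf.eval z := by
      simp only [hgdef]; field_simp
    rw [he' z hz, h4]
    simp only [Polynomial.eval_mul, Polynomial.eval_C, Polynomial.eval_sub]
    field_simp
  · intro z hz
    simpa using ⟨hκ, hd2 z hz⟩
  · intro z hz
    have h1 := hqf z (subset_closure hz)
    have h2 := hd2 z hz
    have h4 : 1 - conj w * g z = (qf.eval z - conj w * pf.eval z) / qf.eval z := by
      simp only [hgdef]; field_simp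
    have h5 : g z - w = (pf.eval z - w * qf.eval z) / qf.eval z := by
      simp only [hgdef]; field_simp
    rw [hFm z (subset_closure hz), hmdef]
    simp only
    rw [h4, h5]
    simp only [Polynomial.eval_mul, Polynomial.eval_C, Polynomial.eval_sub]
    field_simp

lemma inj_of_Ico {γ : ℝ → ℂ} (hper : Function.Periodic γ 1) (hinj : Set.InjOn γ (Set.Ico (0:ℝ) 1)) :
    ∀ x y, γ x = γ y → |x - y| < 1 → x = y := by
  intro x y h hxy
  have e : ∀ x, γ (Int.fract x) = γ x := fun x => by
    have := hper.sub_int_mul_eq ⌊x⌋ (x := x)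
    rwa [mul_one] at this
  have h1 : Int.fract x = Int.fract y :=
    hinj ⟨Int.fract_nonneg x, Int.fract_lt_one x⟩ ⟨Int.fract_nonneg y, Int.fract_lt_one y⟩
      (by rw [e, e, h])
  obtain ⟨n, hn⟩ := Int.fract_eq_fract.1 h1
  rw [hn] at hxy
  have h2 : |n| < 1 := by exact_mod_cast hxy
  rw [Int.abs_lt_one_iff] at h2
  rw [h2] at hn
  simp at hn
  linarith

end

/-- for a bounded simply connected domain with `C²` smooth boundary, the Szegő
kernel is rational iff there is a rational biholomorphism `f` of `Ω` onto the unit disc whose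
derivative is the square of a rational function on `Ω`. -/
theorem szego_kernel_rational_iff_simply_connected_case
    (Ω : Set ℂ) (hne : Ω.Nonempty) (hop : IsOpen Ω) (hconn : IsConnected Ω)
    (hbd : Bornology.IsBounded Ω) (hcompl : IsConnected Ωᶜ)
    (γ : ℝ → ℂ) (hγ : ContDiff ℝ 2 γ) (hper : Function.Periodic γ 1)
    (hinj : Set.InjOn γ (Set.Ico (0:ℝ) 1)) (hder : ∀ t, deriv γ t ≠ 0)
    (hbound : frontier Ω = Set.range γ)
    (S : ℂ → ℂ → ℂ) (hS : IsSzegoKernel Ω S) :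
    (∃ P Q : MvPolynomial (Fin 2) ℂ, Q ≠ 0 ∧
      ∀ z ∈ Ω, ∀ w ∈ Ω,
        S z w * MvPolynomial.eval ![z, conj w] Q = MvPolynomial.eval ![z, conj w] P) ↔
    ∃ f : ℂ → ℂ, IsRationalBiholoOntoDisc Ω f ∧
      ∃ p q : Polynomial ℂ, (∀ z ∈ Ω, q.eval z ≠ 0) ∧
        ∀ z ∈ Ω, deriv f z = (p.eval z / q.eval z) ^ 2 := by
  obtain ⟨γ', D⟩ := exists_dom hop hconn hbd
    (RegCurve.mk hγ hper (inj_of_Ico hper hinj) hder) hbound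
  constructor
  · rintro ⟨P, Q, hQ, h⟩
    exact dir1 D hS hQ h
  · rintro ⟨f, hf, p, q, hq, hr⟩
    exact dir2 D hS hf hq hr
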